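/- arXiv:math/9907076 — 2 statements merged into one kernel-verified Lean document; each statement's English description precedes it below -/
import Mathlib

section
/- Let G be a graph on d vertices and write Y_G = Σ_{π ∈ Π_d} c_π e_π in the noncommutative elementary symmetric function basis. Then for any fixed vertex v_0, the number of acyclic orientations of G with unique sink at v_0 equals (d−1)! · c_{[d]}, where [d] denotes the one-block partition. -/
open Finset

attribute [local instance] Classical.propDecidable

/-- Homogeneous degree-`d` noncommutative symmetric functions, viewed as
coefficient functions on words of length `d` in the variables. -/
abbrev NCF (d : ℕ) := (Fin d → ℕ) → ℚ

/-- A coloring is proper for the edge family `ends` if the endpoints of every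
edge receive distinct colors. -/
def Proper {d : ℕ} {ε : Type*} {C : Type*} (ends : ε → Sym2 (Fin d)) (w : Fin d → C) : Prop :=
  ∀ (e : ε) (i j : Fin d), ends e = s(i, j) → w i ≠ w j

/-- The noncommutative chromatic symmetric function `Y_G`. -/
noncomputable def Y {d : ℕ} {ε : Type*} (ends : ε → Sym2 (Fin d)) : NCF d :=
  fun w => if Proper ends w then 1 else 0

/-- Noncommutative monomial symmetric function indexed by a set partition. -/
noncomputable def mFun {d : ℕ} (π : Setoid (Fin d)) : NCF d :=
  fun w => if (∀ i j, w i = w j ↔ π i j) then 1 else 0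

/-- Noncommutative power sum symmetric function indexed by a set partition. -/
noncomputable def pFun {d : ℕ} (π : Setoid (Fin d)) : NCF d :=
  fun w => if (∀ i j, π i j → w i = w j) then 1 else 0

/-- Noncommutative elementary symmetric function indexed by a set partition. -/
noncomputable def eFun {d : ℕ} (π : Setoid (Fin d)) : NCF d :=
  fun w => if (∀ i j, i ≠ j → π i j → w i ≠ w j) then 1 else 0

noncomputable instance setoidFintype (d : ℕ) : Fintype (Setoid (Fin d)) :=
  Fintype.ofInjective (fun s : Setoid (Fin d) => (s : Fin d → Fin d → Prop))
    (fun s t h => Setoid.ext fun a b => by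
      have := congrFun (congrFun h a) b; simpa using this.to_iff)

/-- Position action of a permutation on words/NCFs. -/
noncomputable def act {d : ℕ} (δ : Equiv.Perm (Fin d)) (f : NCF d) : NCF d :=
  fun w => f (w ∘ δ)

/-- The induction operator `↑`, repeating the last variable. -/
noncomputable def up {n : ℕ} (f : NCF (n + 1)) : NCF (n + 2) :=
  fun w => if w (Fin.last (n + 1)) = w ⟨n, by omega⟩ then f (fun i => w i.castSucc) else 0

/-- Vertex map collapsing the last vertex onto the next-to-last one (for contraction). -/
def collapse {n : ℕ} : Fin (n + 2) → Fin (n + 1) :=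
  fun i => if h : (i : ℕ) < n + 1 then ⟨i, h⟩ else ⟨n, by omega⟩

/-- The partition of `[d]` into connected components of the spanning subgraph with edge set `S`. -/
def components {d : ℕ} {ε : Type*} (ends : ε → Sym2 (Fin d)) (S : Finset ε) :
    Setoid (Fin d) :=
  Relation.EqvGen.setoid (fun i j => ∃ e ∈ S, ends e = s(i, j))

/-- The size of the block of `π` containing `i`. -/
noncomputable def blockCard {n : ℕ} (π : Setoid (Fin n)) (i : Fin n) : ℕ :=
  (Finset.univ.filter (fun j => π i j)).card

/-- The multiset of block sizes (the type `λ(π)`) of a set partition. -/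
noncomputable def sizes {n : ℕ} (π : Setoid (Fin n)) : Multiset ℕ :=
  (Finset.univ.image (fun i => Finset.univ.filter (fun j => π i j))).val.map Finset.card

/-- `σ ≡ᵢ τ` : same type and blocks containing `i` of equal size. -/
def cls {n : ℕ} (i : Fin n) (σ τ : Setoid (Fin n)) : Prop :=
  sizes σ = sizes τ ∧ blockCard σ i = blockCard τ i

/-- Congruence modulo `i` of noncommutative symmetric functions: the amalgamated
coefficients of their `e`-expansions agree on every `≡ᵢ`-class. -/
noncomputable def EquivI {n : ℕ} (i : Fin n) (F G : NCF n) : Prop :=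
  ∃ a b : Setoid (Fin n) → ℚ,
    F = ∑ τ : Setoid (Fin n), a τ • eFun τ ∧
    G = ∑ τ : Setoid (Fin n), b τ • eFun τ ∧
    ∀ τ, (∑ σ : Setoid (Fin n), if cls i σ τ then a σ else 0)
        = ∑ σ : Setoid (Fin n), if cls i σ τ then b σ else 0

/-- `(e)`-positivity with respect to the congruence modulo `i`. -/
noncomputable def EPos {n : ℕ} (i : Fin n) (F : NCF n) : Prop :=
  ∃ a : Setoid (Fin n) → ℚ,
    F = ∑ τ : Setoid (Fin n), a τ • eFun τ ∧
    ∀ τ, 0 ≤ ∑ σ : Setoid (Fin n), if cls i σ τ then a σ else 0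

/-- `(e)`-positivity of a labeled graph: for some labeling and some congruence. -/
noncomputable def EPosG {d : ℕ} {ε : Type*} (ends : ε → Sym2 (Fin d)) : Prop :=
  ∃ (δ : Equiv.Perm (Fin d)) (i : Fin d),
    EPos i (Y (fun e => (ends e).map δ))

/-- Extend a partition of `{0,…,n}` to one of `{0,…,n+m}`: old blocks are kept,
the new elements (indices `≥ n+1`) satisfying `Q` are merged into the block of
the old last element `n`, and the remaining new elements form singletons. -/
def extendB {n : ℕ} (m : ℕ) (π : Setoid (Fin (n + 1))) (Q : ℕ → Prop) :
    Setoid (Fin (n + 1 + m)) where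
  r x y := x = y ∨
    (∃ (hx : (x : ℕ) < n + 1) (hy : (y : ℕ) < n + 1), π ⟨x, hx⟩ ⟨y, hy⟩) ∨
    (((∃ hx : (x : ℕ) < n + 1, π ⟨x, hx⟩ (Fin.last n)) ∨ (n + 1 ≤ (x : ℕ) ∧ Q (x : ℕ))) ∧
     ((∃ hy : (y : ℕ) < n + 1, π ⟨y, hy⟩ (Fin.last n)) ∨ (n + 1 ≤ (y : ℕ) ∧ Q (y : ℕ))))
  iseqv := by
    constructor
    · intro x; exact Or.inl rfl
    · rintro x y (rfl | ⟨hx, hy, h⟩ | ⟨h1, h2⟩)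
      · exact Or.inl rfl
      · exact Or.inr (Or.inl ⟨hy, hx, π.symm h⟩)
      · exact Or.inr (Or.inr ⟨h2, h1⟩)
    · rintro x y z (rfl | ⟨hx, hy, h⟩ | ⟨h1, h2⟩) h'
      · exact h'
      · rcases h' with rfl | ⟨hy', hz, h''⟩ | ⟨h1', h2'⟩
        · exact Or.inr (Or.inl ⟨hx, hy, h⟩)
        · exact Or.inr (Or.inl ⟨hx, hz, π.trans h h''⟩)
        · rcases h1' with ⟨hy', hB⟩ | ⟨hge, _⟩
          · exact Or.inr (Or.inr ⟨Or.inl ⟨hx, π.trans h hB⟩, h2'⟩)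
          · omega
      · rcases h' with rfl | ⟨hy', hz, h''⟩ | ⟨h1', h2'⟩
        · exact Or.inr (Or.inr ⟨h1, h2⟩)
        · rcases h2 with ⟨hy2, hB⟩ | ⟨hge, _⟩
          · exact Or.inr (Or.inr ⟨h1, Or.inl ⟨hz, π.trans (π.trans (π.symm h'') hB) (π.refl _)⟩⟩)
          · omega
        · exact Or.inr (Or.inr ⟨h1, h2'⟩)

/-- `π + (n+1)` : insert the new element `n+1` into the block containing `n`. -/
def addLast {n : ℕ} (π : Setoid (Fin (n + 1))) : Setoid (Fin (n + 2)) :=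
  extendB 1 π (fun _ => True)

/-- `π / (n+1)` : add the new element `n+1` as a singleton block. -/
def addSingleton {n : ℕ} (π : Setoid (Fin (n + 1))) : Setoid (Fin (n + 2)) :=
  extendB 1 π (fun _ => False)

/-- `σ / (d+1),…,(d+m)` : add the new elements as one additional block. -/
def addBlock {d : ℕ} (m : ℕ) (σ : Setoid (Fin d)) : Setoid (Fin (d + m)) where
  r x y := (∃ (hx : (x : ℕ) < d) (hy : (y : ℕ) < d), σ ⟨x, hx⟩ ⟨y, hy⟩) ∨
    (d ≤ (x : ℕ) ∧ d ≤ (y : ℕ))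
  iseqv := by
    constructor
    · intro x
      by_cases h : (x : ℕ) < d
      · exact Or.inl ⟨h, h, σ.refl _⟩
      · exact Or.inr ⟨by omega, by omega⟩
    · rintro x y (⟨hx, hy, h⟩ | ⟨hx, hy⟩)
      · exact Or.inl ⟨hy, hx, σ.symm h⟩
      · exact Or.inr ⟨hy, hx⟩
    · rintro x y z (⟨hx, hy, h⟩ | ⟨hx, hy⟩) (⟨hy', hz, h'⟩ | ⟨hy', hz⟩)
      · exact Or.inl ⟨hx, hz, σ.trans h h'⟩
      · omega
      · omega
      · exact Or.inr ⟨hx, hz⟩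

noncomputable instance setoidLFO (d : ℕ) : LocallyFiniteOrder (Setoid (Fin d)) :=
  Fintype.toLocallyFiniteOrder

/-- The Möbius function of the lattice of set partitions, with values in `ℚ`. -/
noncomputable def muS {d : ℕ} (a b : Setoid (Fin d)) : ℚ :=
  IncidenceAlgebra.mu ℚ a b

/-- Falling factorial `⟨m⟩_i = m(m-1)⋯(m-i+1)` as a rational number. -/
def ffact (m i : ℕ) : ℚ := ∏ j ∈ Finset.range i, ((m : ℚ) - j)

/-- Rising factorial `(b)_i = b(b+1)⋯(b+i-1)` as a rational number. -/
def rfact (b i : ℕ) : ℚ := ∏ j ∈ Finset.range i, ((b : ℚ) + j)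

/-- The path `P_{n+1}` with edges `v_i v_{i+1}`. -/
def pathEnds (n : ℕ) : Fin n → Sym2 (Fin (n + 1)) :=
  fun e => s(e.castSucc, e.succ)

/-- The cycle `C_{n+1}` with edges `v_i v_{i+1}` (indices mod `n+1`). -/
def cycleEnds (n : ℕ) : Fin (n + 1) → Sym2 (Fin (n + 1)) :=
  fun i => s(i, i + 1)

/-- The commutative chromatic symmetric function `X_G` in `N` variables. -/
noncomputable def Xcomm {d : ℕ} {ε : Type*} (ends : ε → Sym2 (Fin d)) (N : ℕ) :
    MvPolynomial (Fin N) ℚ :=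
  ∑ κ : Fin d → Fin N, if Proper ends κ then ∏ i, MvPolynomial.X (κ i) else 0

section Orientations

variable {V : Type*} {ε : Type*}

/-- `o` is an orientation of the graph with edge endpoints `ends`. -/
def IsOrient (ends : ε → Sym2 V) (o : ε → V × V) : Prop :=
  ∀ e, s((o e).1, (o e).2) = ends e

/-- An orientation is acyclic when it admits no directed cycle. -/
def Acyclic (o : ε → V × V) : Prop :=
  ∀ v : V, ¬ Relation.TransGen (fun a b => ∃ e, o e = (a, b)) v v

/-- `v` is a sink: every edge incident to `v` is directed toward `v`. -/
def IsSink (o : ε → V × V) (v : V) : Prop := ∀ e, (o e).1 ≠ v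

/-- The set of acyclic orientations with unique sink `v₀`. -/
def Aset (ends : ε → Sym2 V) (v₀ : V) : Set (ε → V × V) :=
  {o | IsOrient ends o ∧ Acyclic o ∧ IsSink o v₀ ∧ ∀ v, IsSink o v → v = v₀}

end Orientations

/-- A circuit: a closed walk `u_0, u_1, …, u_m, u_0` with distinct vertices and
distinct edges. -/
structure Circuit {d : ℕ} {ε : Type*} (ends : ε → Sym2 (Fin d)) where
  m : ℕ
  v : Fin (m + 1) → Fin d
  f : Fin (m + 1) → ε
  hv : Function.Injective v
  hf : Function.Injective f
  he : ∀ k, ends (f k) = s(v k, v (k + 1))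

/-- The broken circuit obtained from a circuit: its edge set with the largest
edge removed. -/
noncomputable def broken {d : ℕ} {ε : Type*} [LinearOrder ε] {ends : ε → Sym2 (Fin d)}
    (C : Circuit ends) : Finset ε :=
  (Finset.univ.image C.f).erase
    ((Finset.univ.image C.f).max'
      ⟨C.f 0, Finset.mem_image_of_mem _ (Finset.mem_univ _)⟩)

/-- `P(α)`: partitions `τ ≤ π+(d+1)` whose blocks can be listed as `B_1,…,B_l`
with `|B_i| = α_i` and `d+1 ∈ B_1`. -/
def Pset {d : ℕ} (π : Setoid (Fin (d + 1))) (l : ℕ) (α : Fin l → ℕ) :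
    Set (Setoid (Fin (d + 2))) :=
  {τ | τ ≤ addLast π ∧ ∃ B : Fin l → Finset (Fin (d + 2)),
    (∀ x y, τ x y ↔ ∃ i, x ∈ B i ∧ y ∈ B i) ∧
    (∀ i j, i ≠ j → Disjoint (B i) (B j)) ∧
    (∀ i, (B i).card = α i) ∧
    ∃ hl : 0 < l, Fin.last (d + 1) ∈ B ⟨0, hl⟩}

/-- `G + K_{m+1}` : attach a complete graph on `{v_{d}, v_{d+1}, …, v_{d+m}}`
(`m` new vertices) to the last vertex of a graph `G` on `d+1` vertices. -/
def attachEnds {d : ℕ} {ε : Type*} (ends : ε → Sym2 (Fin (d + 1))) (m : ℕ) :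
    ε ⊕ {p : Fin (m + 1) × Fin (m + 1) // p.1 < p.2} → Sym2 (Fin (d + 1 + m))
  | Sum.inl e => (ends e).map (fun x : Fin (d + 1) => (⟨(x : ℕ), by omega⟩ : Fin (d + 1 + m)))
  | Sum.inr p => s(⟨d + (p.1.1 : ℕ), by omega⟩, ⟨d + (p.1.2 : ℕ), by omega⟩)

/-- The disjoint union `G ⊎ K_m`, with the clique on the `m` new vertices. -/
def disjEnds {d : ℕ} {ε : Type*} (ends : ε → Sym2 (Fin d)) (m : ℕ) :
    ε ⊕ {p : Fin m × Fin m // p.1 < p.2} → Sym2 (Fin (d + m))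
  | Sum.inl e => (ends e).map (Fin.castAdd m)
  | Sum.inr p => s(Fin.natAdd d p.1.1, Fin.natAdd d p.1.2)

section ChromaticPolynomial

variable {V : Type*} {ε : Type*} {C : Type*}

/-- Proper colorings of a multigraph on an arbitrary vertex type. -/
def IsProperColoring (ends : ε → Sym2 V) (w : V → C) : Prop :=
  ∀ e, ¬ ((ends e).map w).IsDiag

/-- The number of proper colorings with `n` colors. -/
noncomputable def numColorings (ends : ε → Sym2 V) (n : ℕ) : ℕ :=
  Nat.card {w : V → Fin n // IsProperColoring ends w}

/-- The polynomial `p` interpolates the number of proper colorings. -/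
def IsChromaticPoly (ends : ε → Sym2 V) (p : Polynomial ℚ) : Prop :=
  ∀ n : ℕ, p.eval (n : ℚ) = numColorings ends n

/-- Delete the vertex `x`, redirecting it to `y`. -/
noncomputable def mergeInto (x : V) (y : {v : V // v ≠ x}) (v : V) : {v : V // v ≠ x} :=
  if hv : v = x then y else ⟨v, hv⟩

/-- Deletion of an edge. -/
def deleteEdge (ends : ε → Sym2 V) (e : ε) : {e' : ε // e' ≠ e} → Sym2 V :=
  fun e' => ends e'

/-- Identification of the vertex `x` with `y`. -/
noncomputable def mergeEnds (ends : ε → Sym2 V) (x : V) (y : {v : V // v ≠ x}) :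
    ε → Sym2 {v : V // v ≠ x} :=
  fun e => (ends e).map (mergeInto x y)

@[simp] lemma mergeInto_self (x : V) (y : {v : V // v ≠ x}) : mergeInto x y x = y := by
  simp [mergeInto]

lemma mergeInto_of_ne {x v : V} (y : {v : V // v ≠ x}) (h : v ≠ x) :
    mergeInto x y v = ⟨v, h⟩ := by
  simp [mergeInto, h]

@[simp] lemma mergeInto_coe {x : V} (y v : {v : V // v ≠ x}) :
    mergeInto x y v = v := by
  simp [mergeInto, v.2]

lemma isProperColoring_mergeEnds (ends : ε → Sym2 V) (x : V) (y : {v : V // v ≠ x})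
    (w : {v : V // v ≠ x} → C) :
    IsProperColoring (mergeEnds ends x y) w ↔
      IsProperColoring ends (w ∘ mergeInto x y) := by
  simp [IsProperColoring, mergeEnds, Sym2.map_map]

lemma isProperColoring_iff_deleteEdge (ends : ε → Sym2 V) {e : ε} {x y : V}
    (he : ends e = s(x, y)) (w : V → C) :
    IsProperColoring ends w ↔ IsProperColoring (deleteEdge ends e) w ∧ w x ≠ w y := by
  constructor
  · intro h
    exact ⟨fun e' => h e', by simpa [he] using h e⟩
  · rintro ⟨h, hxy⟩ e'
    by_cases h' : e' = e
    · subst h'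
      simpa [he] using hxy
    · exact h ⟨e', h'⟩

lemma numColorings_zero [Nonempty V] (ends : ε → Sym2 V) : numColorings ends 0 = 0 := by
  have : IsEmpty (V → Fin 0) := ⟨fun w => (w (Classical.arbitrary V)).elim0⟩
  simp [numColorings]

lemma numColorings_of_isDiag (ends : ε → Sym2 V) {e : ε} (he : (ends e).IsDiag) (n : ℕ) :
    numColorings ends n = 0 := by
  have : IsEmpty {w : V → Fin n // IsProperColoring ends w} := by
    refine ⟨fun w => w.2 e ?_⟩
    generalize ends e = z at he
    induction z with
    | _ a b =>
      have : a = b := by simpa using he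
      simp [this]
  simp [numColorings]

/-- Colorings of the merged graph are the colorings giving the merged vertices equal colors. -/
noncomputable def mergedColoringEquiv (ends : ε → Sym2 V) (x : V) (y : {v : V // v ≠ x}) :
    {w : {v : V // v ≠ x} → C // IsProperColoring (mergeEnds ends x y) w} ≃
      {w : V → C // IsProperColoring ends w ∧ w x = w y} where
  toFun w := ⟨w.1 ∘ mergeInto x y, (isProperColoring_mergeEnds ends x y w.1).1 w.2, by simp⟩
  invFun w := ⟨fun v => w.1 v, by
    rw [isProperColoring_mergeEnds]
    convert w.2.1 using 1
    funext v
    by_cases hv : v = x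
    · subst hv
      simp [w.2.2]
    · simp [mergeInto_of_ne y hv]⟩
  left_inv w := by
    ext v
    simp
  right_inv w := by
    ext v
    by_cases hv : v = x
    · subst hv
      simp [w.2.2]
    · simp [mergeInto_of_ne y hv]

lemma numColorings_deleteEdge [Finite V] (ends : ε → Sym2 V) {e : ε} {x : V}
    (y : {v : V // v ≠ x}) (he : ends e = s(x, (y : V))) (n : ℕ) :
    numColorings (deleteEdge ends e) n =
      numColorings ends n + numColorings (mergeEnds (deleteEdge ends e) x y) n := by
  have : Fintype V := Fintype.ofFinite V
  unfold numColorings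
  rw [Nat.card_congr (mergedColoringEquiv (C := Fin n) (deleteEdge ends e) x y)]
  simp only [Nat.card_eq_fintype_card, Fintype.card_subtype]
  simp only [isProperColoring_iff_deleteEdge ends he]
  rw [← Finset.card_filter_add_card_filter_not (s := Finset.univ.filter
    (IsProperColoring (C := Fin n) (deleteEdge ends e))) (fun w => w x ≠ w y)]
  simp [Finset.filter_filter]

/-- A vertex without incident edges can be colored freely. -/
noncomputable def isolatedColoringEquiv (ends : ε → Sym2 V) (x : V) (y : {v : V // v ≠ x})
    (hx : ∀ e, x ∉ ends e) :
    {w : V → C // IsProperColoring ends w} ≃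
      C × {w : {v : V // v ≠ x} → C // IsProperColoring (mergeEnds ends x y) w} where
  toFun w := ⟨w.1 x, fun v => w.1 v, by
    rw [isProperColoring_mergeEnds]
    intro e
    rw [Sym2.map_congr (g := w.1)]
    · exact w.2 e
    · intro v hv
      have : v ≠ x := fun h => hx e (h ▸ hv)
      simp [mergeInto_of_ne y this]⟩
  invFun w := ⟨fun v => if hv : v = x then w.1 else w.2.1 ⟨v, hv⟩, by
    intro e
    rw [Sym2.map_congr (g := w.2.1 ∘ mergeInto x y)]
    · exact (isProperColoring_mergeEnds ends x y w.2.1).1 w.2.2 e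
    · intro v hv
      have : v ≠ x := fun h => hx e (h ▸ hv)
      simp [mergeInto_of_ne y this, this]⟩
  left_inv w := by
    ext v
    by_cases hv : v = x
    · subst hv
      simp
    · simp [hv]
  right_inv w := by
    ext v
    · simp
    · simp [v.2]

lemma numColorings_of_isolated (ends : ε → Sym2 V) (x : V) (y : {v : V // v ≠ x})
    (hx : ∀ e, x ∉ ends e) (n : ℕ) :
    numColorings ends n = n * numColorings (mergeEnds ends x y) n := by
  unfold numColorings
  rw [Nat.card_congr (isolatedColoringEquiv (C := Fin n) ends x y hx), Nat.card_prod]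
  simp

lemma numColorings_of_isEmpty [IsEmpty ε] (ends : ε → Sym2 V) (n : ℕ) [Finite V] :
    numColorings ends n = n ^ Nat.card V := by
  have : Fintype V := Fintype.ofFinite V
  have h : ∀ w : V → Fin n, IsProperColoring ends w := fun w e => isEmptyElim e
  simp [numColorings, h]

lemma card_ne_lt [Finite ε] (e : ε) : Nat.card {e' : ε // e' ≠ e} < Nat.card ε := by
  have : Fintype ε := Fintype.ofFinite ε
  simpa only [Nat.card_eq_fintype_card] using
    Fintype.card_subtype_lt (p := fun e' => e' ≠ e) (x := e) (by simp)

lemma card_ne_add_one [Finite V] (x : V) : Nat.card {v : V // v ≠ x} + 1 = Nat.card V := by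
  have : Fintype V := Fintype.ofFinite V
  have hpos : 0 < Fintype.card V := Fintype.card_pos_iff.2 ⟨x⟩
  have := Fintype.card_subtype_compl (fun v : V => v = x)
  simp only [Fintype.card_subtype_eq] at this
  simp only [Nat.card_eq_fintype_card, ne_eq]
  omega

theorem exists_isChromaticPoly.{u, v} {V : Type u} {ε : Type v} [Finite V] [Finite ε]
    (ends : ε → Sym2 V) : ∃ p, IsChromaticPoly ends p := by
  induction hk : Nat.card ε using Nat.strong_induction_on generalizing V ε with
  | _ k ih =>
  subst hk
  rcases isEmpty_or_nonempty ε with hε | ⟨⟨e⟩⟩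
  · exact ⟨Polynomial.X ^ Nat.card V, fun n => by simp [numColorings_of_isEmpty]⟩
  · by_cases hd : (ends e).IsDiag
    · exact ⟨0, fun n => by simp [numColorings_of_isDiag ends hd]⟩
    · obtain ⟨x, y, he⟩ : ∃ x y, ends e = s(x, y) := by
        induction h : ends e with
        | _ x y => exact ⟨x, y, rfl⟩
      have hyx : y ≠ x := by
        rintro rfl
        exact hd (by simp [he])
      obtain ⟨p, hp⟩ := ih _ (card_ne_lt e) (deleteEdge ends e) rfl
      obtain ⟨q, hq⟩ := ih _ (card_ne_lt e) (mergeEnds (deleteEdge ends e) x ⟨y, hyx⟩) rfl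
      refine ⟨p - q, fun n => ?_⟩
      rw [Polynomial.eval_sub, hp, hq, numColorings_deleteEdge ends ⟨y, hyx⟩ he]
      push_cast
      ring

lemma polynomial_eq_of_eval_natCast {p q : Polynomial ℚ}
    (h : ∀ n : ℕ, p.eval (n : ℚ) = q.eval (n : ℚ)) : p = q := by
  refine Polynomial.eq_of_infinite_eval_eq p q ?_
  refine (Set.infinite_range_of_injective (Nat.cast_injective (R := ℚ))).mono ?_
  rintro _ ⟨n, rfl⟩
  exact h n

end ChromaticPolynomial

section UniqueSink

variable {V : Type*} {ε : Type*}

lemma acyclic_iff_exists_rank [Finite V] (o : ε → V × V) :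
    Acyclic o ↔ ∃ f : V → ℕ, ∀ e, f (o e).2 < f (o e).1 := by
  constructor
  · intro h
    refine ⟨fun v => {b | Relation.TransGen (fun a b => ∃ e, o e = (a, b)) v b}.ncard,
      fun e => Set.ncard_lt_ncard ?_ (Set.toFinite _)⟩
    have he : Relation.TransGen (fun a b => ∃ e, o e = (a, b)) (o e).1 (o e).2 :=
      Relation.TransGen.single ⟨e, rfl⟩
    refine ⟨fun b hb => he.trans hb, fun hsub => h (o e).2 (hsub he)⟩
  · rintro ⟨f, hf⟩ v hv
    have key : ∀ a b, Relation.TransGen (fun a b => ∃ e, o e = (a, b)) a b → f b < f a := by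
      intro a b hab
      induction hab with
      | single h =>
        obtain ⟨e, he⟩ := h
        simpa [he] using hf e
      | tail _ h ih =>
        obtain ⟨e, he⟩ := h
        have := hf e
        simp only [he] at this
        exact this.trans ih
    exact lt_irrefl _ (key v v hv)

lemma exists_isSink_mem [Finite V] {o : ε → V × V} (ho : Acyclic o) {S : Set V}
    (hS : S.Nonempty) (hclosed : ∀ e, (o e).1 ∈ S → (o e).2 ∈ S) :
    ∃ v ∈ S, IsSink o v := by
  obtain ⟨f, hf⟩ := (acyclic_iff_exists_rank o).1 ho
  obtain ⟨v, hv, hmin⟩ := Set.exists_min_image S f S.toFinite hS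
  refine ⟨v, hv, fun e he => ?_⟩
  have h1 := hmin _ (hclosed e (he ▸ hv))
  have h2 := hf e
  rw [he] at h2
  omega

lemma Aset_eq_empty_of_closed [Finite V] (ends : ε → Sym2 V) {v₀ : V} {S : Set V}
    (hS : S.Nonempty) (hv₀ : v₀ ∉ S) (hclosed : ∀ e a b, ends e = s(a, b) → a ∈ S → b ∈ S) :
    Aset ends v₀ = ∅ := by
  refine Set.eq_empty_of_forall_notMem fun o ho => ?_
  obtain ⟨v, hv, hsink⟩ := exists_isSink_mem ho.2.1 hS
    (fun e h => hclosed e _ _ (ho.1 e).symm h)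
  exact hv₀ (ho.2.2.2 v hsink ▸ hv)

lemma Aset_eq_empty_of_isDiag (ends : ε → Sym2 V) (v₀ : V) {e : ε} (he : (ends e).IsDiag) :
    Aset ends v₀ = ∅ := by
  refine Set.eq_empty_of_forall_notMem fun o ho => ?_
  have h := ho.1 e
  rw [← h] at he
  have he' : (o e).1 = (o e).2 := by simpa using he
  exact ho.2.1 (o e).1 (Relation.TransGen.single ⟨e, Prod.ext rfl he'.symm⟩)

lemma apply_eq_of_mem_Aset {ends : ε → Sym2 V} {v₀ u : V} {e : ε} (he : ends e = s(u, v₀))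
    {o : ε → V × V} (ho : o ∈ Aset ends v₀) : o e = (u, v₀) := by
  have h := ho.1 e
  rw [he, Sym2.eq_iff] at h
  rcases h with ⟨h1, h2⟩ | ⟨h1, -⟩
  · exact Prod.ext h1 h2
  · exact absurd h1 (ho.2.2.1 e)

/-- Extend an orientation of `G - e` to one of `G`. -/
noncomputable def extendOrient (e : ε) (p : V × V) (o : {e' : ε // e' ≠ e} → V × V) : ε → V × V :=
  fun e' => if h : e' = e then p else o ⟨e', h⟩

@[simp] lemma extendOrient_self (e : ε) (p : V × V) (o : {e' : ε // e' ≠ e} → V × V) :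
    extendOrient e p o e = p := by
  simp [extendOrient]

@[simp] lemma extendOrient_coe (e : ε) (p : V × V) (o : {e' : ε // e' ≠ e} → V × V)
    (e' : {e' : ε // e' ≠ e}) : extendOrient e p o e' = o e' := by
  simp [extendOrient, e'.2]

lemma forall_iff_forall_ne (e : ε) (P : ε → Prop) :
    (∀ e', P e') ↔ P e ∧ ∀ e' : {e' : ε // e' ≠ e}, P e' := by
  refine ⟨fun h => ⟨h e, fun e' => h e'⟩, fun h e' => ?_⟩
  by_cases h' : e' = e
  · exact h' ▸ h.1
  · exact h.2 ⟨e', h'⟩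

lemma injOn_restrict_Aset {ends : ε → Sym2 V} {v₀ u : V} {e : ε} (he : ends e = s(u, v₀)) :
    Set.InjOn (fun (o : ε → V × V) (e' : {e' : ε // e' ≠ e}) => o e') (Aset ends v₀) := by
  intro o ho o' ho' h
  funext e'
  revert e'
  rw [forall_iff_forall_ne e]
  exact ⟨by rw [apply_eq_of_mem_Aset he ho, apply_eq_of_mem_Aset he ho'],
    fun e' => congrFun h e'⟩

lemma ncard_Aset_deleteEdge [Finite V] (ends : ε → Sym2 V) {v₀ u : V} {e : ε}
    (hu : u ≠ v₀) (he : ends e = s(u, v₀)) :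
    {o ∈ Aset ends v₀ | ∃ e' ≠ e, (o e').1 = u}.ncard = (Aset (deleteEdge ends e) v₀).ncard := by
  rw [← ((injOn_restrict_Aset he).mono (Set.sep_subset _ _)).ncard_image]
  congr 1
  ext o
  constructor
  · rintro ⟨o, ⟨ho, e₁, he₁, hu₁⟩, rfl⟩
    have hoe := apply_eq_of_mem_Aset he ho
    obtain ⟨hor, hac, hs, huniq⟩ := ho
    obtain ⟨f, hf⟩ := (acyclic_iff_exists_rank o).1 hac
    refine ⟨fun e' => hor e', (acyclic_iff_exists_rank _).2 ⟨f, fun e' => hf e'⟩,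
      fun e' => hs e', fun v hv => huniq v fun e' he' => ?_⟩
    by_cases h : e' = e
    · subst h
      rw [hoe] at he'
      exact hv ⟨e₁, he₁⟩ (hu₁.trans he')
    · exact hv ⟨e', h⟩ he'
  · intro ho
    obtain ⟨hor, hac, hs, huniq⟩ := ho
    obtain ⟨f, hf⟩ := (acyclic_iff_exists_rank o).1 hac
    refine ⟨extendOrient e (u, v₀) o, ⟨⟨?_, ?_, ?_, ?_⟩, ?_⟩, by funext e'; simp⟩
    · unfold IsOrient
      rw [forall_iff_forall_ne e]
      exact ⟨by simp [he], fun e' => by simpa [deleteEdge] using hor e'⟩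
    · refine (acyclic_iff_exists_rank _).2 ⟨fun v => if v = v₀ then 0 else f v + 1, ?_⟩
      rw [forall_iff_forall_ne e]
      refine ⟨by simp [hu], fun e' => ?_⟩
      have h1 := hs e'
      have h2 := hf e'
      simp only [extendOrient_coe, if_neg h1]
      split_ifs <;> omega
    · unfold IsSink
      rw [forall_iff_forall_ne e]
      exact ⟨by simpa using hu, fun e' => by simpa using hs e'⟩
    · intro v hv
      exact huniq v fun e' => by simpa using hv e'
    · by_contra hcon
      refine hu (huniq u fun e' he' => hcon ⟨e', e'.2, by simpa using he'⟩)

lemma exists_lift_of_mk_eq_map {W : Type*} (r : V → W) (z : Sym2 V) (q : W × W)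
    (h : s(q.1, q.2) = z.map r) : ∃ p : V × V, s(p.1, p.2) = z ∧ Prod.map r r p = q := by
  induction z with
  | _ a b =>
    rw [Sym2.map_mk, Sym2.eq_iff] at h
    rcases h with ⟨h1, h2⟩ | ⟨h1, h2⟩
    · exact ⟨(a, b), rfl, Prod.ext h1.symm h2.symm⟩
    · exact ⟨(b, a), Sym2.eq_swap, Prod.ext h1.symm h2.symm⟩

lemma mergeInto_eq_self_iff {u : V} (y : {v : V // v ≠ u}) (v : V) :
    mergeInto u y v = y ↔ v = u ∨ v = y := by
  by_cases h : v = u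
  · simp [h]
  · simp [mergeInto_of_ne y h, h, Subtype.ext_iff]

lemma ncard_Aset_mergeEnds [Finite V] (ends : ε → Sym2 V) {u : V} (y : {v : V // v ≠ u}) {e : ε}
    (he : ends e = s(u, (y : V))) :
    {o ∈ Aset ends (y : V) | ¬ ∃ e' ≠ e, (o e').1 = u}.ncard =
      (Aset (mergeEnds (deleteEdge ends e) u y) y).ncard := by
  have hinj : Set.InjOn (fun (o : ε → V × V) (e' : {e' : ε // e' ≠ e}) =>
      Prod.map (mergeInto u y) (mergeInto u y) (o e'))
      {o ∈ Aset ends (y : V) | ¬ ∃ e' ≠ e, (o e').1 = u} := by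
    rintro o ⟨ho, hou⟩ o' ⟨ho', hou'⟩ h
    refine injOn_restrict_Aset he ho ho' (funext fun e' => ?_)
    push Not at hou hou'
    have h1 := congrArg Prod.fst (congrFun h e')
    have h2 : mergeInto u y (o e').1 = ⟨(o e').1, hou e' e'.2⟩ := mergeInto_of_ne _ _
    have h3 : mergeInto u y (o' e').1 = ⟨(o' e').1, hou' e' e'.2⟩ := mergeInto_of_ne _ _
    simp only [Prod.map_fst, h2, h3, Subtype.mk.injEq] at h1
    have h4 := (ho.1 e').trans (ho'.1 e').symm
    rw [h1, Sym2.congr_right] at h4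
    exact Prod.ext h1 h4
  rw [← hinj.ncard_image]
  congr 1
  ext q
  constructor
  · rintro ⟨o, ⟨ho, hou⟩, rfl⟩
    push Not at hou
    have hoe := apply_eq_of_mem_Aset he ho
    obtain ⟨hor, hac, hs, huniq⟩ := ho
    obtain ⟨f, hf⟩ := (acyclic_iff_exists_rank o).1 hac
    refine ⟨fun e' => ?_, ?_, fun e' h => ?_, fun v hv => ?_⟩
    · simp [mergeEnds, deleteEdge, ← hor e']
    · refine (acyclic_iff_exists_rank _).2
        ⟨fun v => if v = y then 0 else f v + 1, fun e' => ?_⟩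
      have h1 : mergeInto u y (o e').1 ≠ y := by
        rw [Ne, mergeInto_eq_self_iff]
        exact not_or.2 ⟨hou e' e'.2, hs e'⟩
      simp only [Prod.map_fst, Prod.map_snd, if_neg h1]
      split_ifs with h2
      · omega
      · rw [mergeInto_eq_self_iff, not_or] at h2
        rw [mergeInto_of_ne y h2.1, mergeInto_of_ne y (hou e' e'.2)]
        have := hf e'
        simpa using this
    · exact (mergeInto_eq_self_iff y _).1 h |>.elim (hou e' e'.2) (hs e')
    · refine Subtype.ext (huniq v ?_)
      unfold IsSink
      rw [forall_iff_forall_ne e]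
      refine ⟨by simpa [hoe] using v.2.symm, fun e' h => hv e' ?_⟩
      simp [h]
  · rintro ⟨hor, hac, hs, huniq⟩
    obtain ⟨f, hf⟩ := (acyclic_iff_exists_rank q).1 hac
    choose o ho hoq using fun e' => exists_lift_of_mk_eq_map (mergeInto u y)
      (deleteEdge ends e e') (q e') (hor e')
    have hq1 : ∀ e', mergeInto u y (o e').1 = (q e').1 := fun e' => congrArg Prod.fst (hoq e')
    have hq2 : ∀ e', mergeInto u y (o e').2 = (q e').2 := fun e' => congrArg Prod.snd (hoq e')
    have hne : ∀ e', (o e').1 ≠ u ∧ (o e').1 ≠ y := fun e' => by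
      rw [← not_or, ← mergeInto_eq_self_iff, hq1]
      exact hs e'
    refine ⟨extendOrient e (u, (y : V)) o, ⟨⟨?_, ?_, ?_, ?_⟩, ?_⟩, funext fun e' => ?_⟩
    · unfold IsOrient
      rw [forall_iff_forall_ne e]
      exact ⟨by simp [he], fun e' => by simpa [deleteEdge] using ho e'⟩
    · refine (acyclic_iff_exists_rank _).2
        ⟨fun v => 2 * f (mergeInto u y v) + if v = u then 1 else 0, ?_⟩
      rw [forall_iff_forall_ne e]
      refine ⟨by simp [y.2], fun e' => ?_⟩
      have := hf e'
      simp only [extendOrient_coe, hq1, hq2]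
      split_ifs <;> omega
    · unfold IsSink
      rw [forall_iff_forall_ne e]
      exact ⟨by simpa using y.2.symm, fun e' => by simpa using (hne e').2⟩
    · intro v hv
      have hvu : v ≠ u := fun h => hv e (by simp [h])
      have : (⟨v, hvu⟩ : {v : V // v ≠ u}) = y := by
        refine huniq _ fun e' h => hv e' ?_
        rw [← hq1, mergeInto_of_ne y (hne e').1] at h
        simpa using h
      exact congrArg Subtype.val this
    · rintro ⟨e', he', h⟩
      exact (hne ⟨e', he'⟩).1 (by simpa [extendOrient, he'] using h)
    · simpa using hoq e'

lemma ncard_Aset_eq_add [Finite V] [Finite ε] (ends : ε → Sym2 V) {u : V} (y : {v : V // v ≠ u})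
    {e : ε} (he : ends e = s(u, (y : V))) :
    (Aset ends (y : V)).ncard = (Aset (deleteEdge ends e) (y : V)).ncard +
      (Aset (mergeEnds (deleteEdge ends e) u y) y).ncard := by
  rw [← ncard_Aset_deleteEdge ends y.2.symm he, ← ncard_Aset_mergeEnds ends y he,
    ← Set.ncard_union_eq _ (Set.toFinite _) (Set.toFinite _)]
  · congr 1
    ext o
    simp only [Set.mem_union, Set.mem_ofPred_eq]
    rw [← and_or_left, and_iff_left (Classical.em _)]
  · rw [Set.disjoint_left]
    exact fun o h h' => h'.2 h.2

/-- Greene–Zaslavsky: acyclic orientations with a fixed unique sink are counted, up to sign, by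
the linear coefficient of the chromatic polynomial. -/
theorem coeff_one_eq_ncard_Aset.{u, v} {V : Type u} {ε : Type v} [Finite V] [Finite ε]
    (ends : ε → Sym2 V) (v₀ : V) (p : Polynomial ℚ) (hp : IsChromaticPoly ends p) :
    p.coeff 1 = (-1) ^ (Nat.card V + 1) * ((Aset ends v₀).ncard : ℚ) := by
  induction hk : Nat.card ε using Nat.strong_induction_on generalizing V ε p with
  | _ k ih =>
  subst hk
  by_cases hinc : ∃ e, v₀ ∈ ends e
  · obtain ⟨e, u, he⟩ := hinc
    rw [Sym2.eq_swap] at he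
    by_cases hu : v₀ = u
    · have hd : (ends e).IsDiag := by simp [he, hu]
      have : p = 0 := polynomial_eq_of_eval_natCast fun n => by
        rw [hp n, numColorings_of_isDiag ends hd]
        simp
      simp [this, Aset_eq_empty_of_isDiag ends v₀ hd]
    · obtain ⟨p₁, hp₁⟩ := exists_isChromaticPoly (deleteEdge ends e)
      obtain ⟨p₂, hp₂⟩ := exists_isChromaticPoly (mergeEnds (deleteEdge ends e) u ⟨v₀, hu⟩)
      have hpp : p = p₁ - p₂ := polynomial_eq_of_eval_natCast fun n => by
        rw [Polynomial.eval_sub, hp n, hp₁ n, hp₂ n, numColorings_deleteEdge ends ⟨v₀, hu⟩ he]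
        push_cast
        ring
      have h₁ := ih _ (card_ne_lt e) _ v₀ p₁ hp₁ rfl
      have h₂ := ih _ (card_ne_lt e) _ ⟨v₀, hu⟩ p₂ hp₂ rfl
      have hA := ncard_Aset_eq_add ends ⟨v₀, hu⟩ he
      simp only at hA
      rw [hpp, Polynomial.coeff_sub, h₁, h₂, hA, ← card_ne_add_one u]
      push_cast
      ring
  · push Not at hinc
    by_cases hV : ∃ y, y ≠ v₀
    · obtain ⟨y, hy⟩ := hV
      have : Nonempty {v : V // v ≠ v₀} := ⟨⟨y, hy⟩⟩
      obtain ⟨q, hq⟩ := exists_isChromaticPoly (mergeEnds ends v₀ ⟨y, hy⟩)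
      have hpq : p = Polynomial.X * q := polynomial_eq_of_eval_natCast fun n => by
        rw [Polynomial.eval_mul, Polynomial.eval_X, hp n, hq n,
          numColorings_of_isolated ends v₀ ⟨y, hy⟩ hinc]
        push_cast
        rfl
      have hA : Aset ends v₀ = ∅ := by
        refine Aset_eq_empty_of_closed ends (S := {v₀}ᶜ) ⟨y, hy⟩ (by simp) ?_
        rintro e a b he - rfl
        exact hinc e (by simp [he])
      have h0 := hq 0
      rw [numColorings_zero, Nat.cast_zero, ← Polynomial.coeff_zero_eq_eval_zero] at h0
      simpa [hpq, hA, Polynomial.coeff_X_mul] using h0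
    · push Not at hV
      have : IsEmpty ε := ⟨fun e => by
        induction h : ends e with
        | _ a b => exact hinc e (by simp [h, hV a])⟩
      have : Unique V := ⟨⟨v₀⟩, hV⟩
      have hpX : p = Polynomial.X := polynomial_eq_of_eval_natCast fun n => by
        rw [hp n, numColorings_of_isEmpty]
        simp
      have hA : Aset ends v₀ = Set.univ := Set.eq_univ_of_forall fun o =>
        ⟨fun e => isEmptyElim e, (acyclic_iff_exists_rank o).2 ⟨fun _ => 0, fun e => isEmptyElim e⟩,
          fun e => isEmptyElim e, fun v _ => hV v⟩
      simp [hpX, hA, Set.ncard_univ]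

end UniqueSink

lemma proper_iff_isProperColoring {d : ℕ} {ε C : Type*} (ends : ε → Sym2 (Fin d))
    (w : Fin d → C) : Proper ends w ↔ IsProperColoring ends w := by
  refine forall_congr' fun e => ?_
  induction h : ends e with
  | _ a b =>
    constructor
    · intro hw
      simpa using hw a b rfl
    · intro hw i j hij
      simpa [hij] using hw

/-- The disjoint union of complete graphs on the blocks of a set partition. -/
def blockEnds {V : Type*} (π : Setoid V) : {p : V × V // p.1 ≠ p.2 ∧ π p.1 p.2} → Sym2 V :=
  fun p => s(p.1.1, p.1.2)

lemma isProperColoring_blockEnds {V C : Type*} (π : Setoid V) (w : V → C) :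
    IsProperColoring (blockEnds π) w ↔ ∀ i j, i ≠ j → π i j → w i ≠ w j := by
  constructor
  · intro h i j hij hπ
    simpa [blockEnds] using h ⟨(i, j), hij, hπ⟩
  · rintro h ⟨⟨i, j⟩, hij, hπ⟩
    simpa [blockEnds] using h i j hij hπ

lemma sum_ite_isProperColoring {V ε : Type*} [Fintype V] (ends : ε → Sym2 V) (n : ℕ) :
    (∑ w : V → Fin n, if IsProperColoring ends w then (1 : ℚ) else 0) = numColorings ends n := by
  rw [numColorings, Nat.card_eq_fintype_card, Fintype.card_subtype, Finset.sum_boole]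

lemma isProperColoring_val_comp {V ε : Type*} (ends : ε → Sym2 V) {n : ℕ} (w : V → Fin n) :
    IsProperColoring ends (fun i => (w i : ℕ)) ↔ IsProperColoring ends w := by
  refine forall_congr' fun e => ?_
  induction ends e with
  | _ a b => simp [Fin.ext_iff]

lemma numColorings_blockEnds_top {V : Type*} [Finite V] (n : ℕ) :
    numColorings (blockEnds (⊤ : Setoid V)) n = n.descFactorial (Nat.card V) := by
  have : Fintype V := Fintype.ofFinite V
  have h : ∀ w : V → Fin n, IsProperColoring (blockEnds (⊤ : Setoid V)) w ↔
      Function.Injective w := fun w => by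
    rw [isProperColoring_blockEnds]
    refine ⟨fun h i j hij => by_contra fun hne => h i j hne trivial hij,
      fun h i j hne _ hij => hne (h hij)⟩
  rw [numColorings, Nat.card_congr ((Equiv.subtypeEquivRight h).trans
    (Equiv.subtypeInjectiveEquivEmbedding V (Fin n))), Nat.card_eq_fintype_card,
    Fintype.card_embedding_eq, Fintype.card_fin, Nat.card_eq_fintype_card]

lemma eval_neg_one_descPochhammer (k : ℕ) :
    (descPochhammer ℚ k).eval (-1) = (-1) ^ k * (k.factorial : ℚ) := by
  induction k with
  | zero => simp
  | succ k ih =>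
    rw [descPochhammer_succ_eval, ih, Nat.factorial_succ]
    push_cast
    ring

lemma coeff_one_descPochhammer_succ (k : ℕ) :
    (descPochhammer ℚ (k + 1)).coeff 1 = (-1) ^ k * (k.factorial : ℚ) := by
  rw [descPochhammer_succ_left, Polynomial.coeff_X_mul, Polynomial.coeff_zero_eq_eval_zero,
    Polynomial.eval_comp, ← eval_neg_one_descPochhammer]
  simp

/-- If `Y_G = Σ_π c_π e_π`, then the number of acyclic orientations of `G` with
a unique sink at `v₀` is `(d-1)! · c_{[d]}`. -/
theorem card_uniqueSink_acyclicOrientations {d : ℕ} {ε : Type*} [Fintype ε]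
    (ends : ε → Sym2 (Fin d)) (v₀ : Fin d) (c : Setoid (Fin d) → ℚ)
    (hc : Y ends = ∑ π : Setoid (Fin d), c π • eFun π) :
    ((Aset ends v₀).ncard : ℚ) = (Nat.factorial (d - 1) : ℚ) * c ⊤ := by
  obtain ⟨p, hp⟩ := exists_isChromaticPoly ends
  choose q hq using fun π : Setoid (Fin d) => exists_isChromaticPoly (blockEnds π)
  have hpq : p = ∑ π : Setoid (Fin d), Polynomial.C (c π) * q π := by
    refine polynomial_eq_of_eval_natCast fun n => ?_
    have hY : ∀ w : Fin d → Fin n, (if IsProperColoring ends w then (1 : ℚ) else 0) =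
        ∑ π : Setoid (Fin d), c π * if IsProperColoring (blockEnds π) w then 1 else 0 := by
      intro w
      have h := congrFun hc fun i => (w i : ℕ)
      simpa only [Y, eFun, Finset.sum_apply, Pi.smul_apply, smul_eq_mul,
        proper_iff_isProperColoring, ← isProperColoring_blockEnds,
        isProperColoring_val_comp] using h
    rw [hp n, ← sum_ite_isProperColoring, Finset.sum_congr rfl fun w _ => hY w, Finset.sum_comm,
      Polynomial.eval_finsetSum]
    refine Finset.sum_congr rfl fun π _ => ?_
    rw [← Finset.mul_sum, sum_ite_isProperColoring, Polynomial.eval_mul, Polynomial.eval_C, hq π n]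
  have hcoeff : ∀ π : Setoid (Fin d), π ≠ ⊤ → (q π).coeff 1 = 0 := by
    intro π hπ
    obtain ⟨v, hv⟩ : ∃ v, ¬ π v v₀ := by
      by_contra! h
      exact hπ (Setoid.eq_top_iff.2 fun a b => π.trans (h a) (π.symm (h b)))
    rw [coeff_one_eq_ncard_Aset (blockEnds π) v₀ _ (hq π),
      Aset_eq_empty_of_closed (blockEnds π) (S := {a | ¬ π a v₀}) ⟨v, hv⟩
        (by simp)]
    · simp
    · rintro ⟨⟨i, j⟩, hij, hπij⟩ a b he ha hb
      simp only [blockEnds, Sym2.eq_iff] at he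
      rcases he with ⟨rfl, rfl⟩ | ⟨rfl, rfl⟩
      · exact ha (π.trans hπij hb)
      · exact ha (π.trans (π.symm hπij) hb)
  have htop : q ⊤ = descPochhammer ℚ d := polynomial_eq_of_eval_natCast fun n => by
    rw [hq ⊤ n, numColorings_blockEnds_top, descPochhammer_eval_eq_descFactorial]
    simp
  have h := coeff_one_eq_ncard_Aset ends v₀ p hp
  rw [hpq, Polynomial.finsetSum_coeff, Finset.sum_eq_single ⊤
    (fun π _ hπ => by rw [Polynomial.coeff_C_mul, hcoeff π hπ, mul_zero]) (by simp),
    Polynomial.coeff_C_mul, htop, Nat.card_fin] at h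
  obtain ⟨k, rfl⟩ : ∃ k, d = k + 1 := ⟨d - 1, by have := v₀.pos; omega⟩
  rw [coeff_one_descPochhammer_succ] at h
  have hsign : ((-1 : ℚ) ^ k) * (-1) ^ k = 1 := by
    rw [← mul_pow]
    simp
  rw [Nat.add_sub_cancel]
  linear_combination (-(-1) ^ k) * h + ((k.factorial : ℚ) * c ⊤ - (Aset ends v₀).ncard) * hsign
end

section
/- For every d ≥ 1, the noncommutative chromatic symmetric function Y_{P_d} of the path P_d with edges v_1v_2,...,v_{d-1}v_d is (e)-positive: all amalgamated coefficients c_{(τ)} in the expansion Y_{P_d} ≡_d Σ_{(τ)} c_{(τ)} e_{(τ)} are nonnegative. Moreover the coefficients satisfy the recursion: if Y_{P_d} ≡_d Σ c_{(τ)} e_{(τ)}, then Y_{P_{d+1}} ≡_{d+1} Σ c_{(τ)}(1 − 1/|B_τ|) e_{(τ/d+1)} + Σ (c_{(τ)}/|B_τ|) e_{(τ+(d+1))}. -/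
open Finset

attribute [local instance] Classical.propDecidable

section SignedOrbits

/-- The sign of a permutation depends only on its orbit partition. -/
theorem sign_eq_of_sameCycle_iff {n : ℕ} {g h : Equiv.Perm (Fin n)}
    (H : ∀ x y, g.SameCycle x y ↔ h.SameCycle x y) :
    Equiv.Perm.sign g = Equiv.Perm.sign h := by
  have key : ∀ f : Equiv.Perm (Fin n),
      f.support = univ.filter (fun x => ∃ y, f.SameCycle x y ∧ x ≠ y) ∧
      f.cycleFactorsFinset.card =
        (f.support.image (fun x => univ.filter (fun y => f.SameCycle x y))).card := by
    intro f
    constructor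
    · ext x
      simp only [Equiv.Perm.mem_support, mem_filter, mem_univ, true_and]
      constructor
      · intro hx
        exact ⟨f x, Equiv.Perm.sameCycle_apply_right.2 (Equiv.Perm.SameCycle.refl _ _), hx.symm⟩
      · rintro ⟨y, ⟨k, hk⟩, hxy⟩ hx
        exact hxy (by rw [← hk]; exact (Equiv.Perm.zpow_apply_eq_self_of_apply_eq_self hx k).symm)
    · have himg : f.support.image (fun x => univ.filter (fun y => f.SameCycle x y))
          = f.cycleFactorsFinset.image Equiv.Perm.support := by
        ext B
        simp only [mem_image]
        constructor
        · rintro ⟨x, hx, rfl⟩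
          refine ⟨f.cycleOf x, Equiv.Perm.cycleOf_mem_cycleFactorsFinset_iff.2 hx, ?_⟩
          ext y
          rw [Equiv.Perm.mem_support_cycleOf_iff]
          simp [hx]
        · rintro ⟨c, hc, rfl⟩
          obtain ⟨x, hx⟩ := (Equiv.Perm.mem_cycleFactorsFinset_iff.1 hc).1.nonempty_support
          have hcx := Equiv.Perm.cycle_is_cycleOf hx hc
          have hxf : x ∈ f.support :=
            Equiv.Perm.mem_cycleFactorsFinset_support_le hc hx
          refine ⟨x, hxf, ?_⟩
          rw [hcx]
          ext y
          rw [Equiv.Perm.mem_support_cycleOf_iff]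
          simp [hxf]
      rw [himg, Finset.card_image_of_injOn]
      intro c hc c' hc' hcc
      obtain ⟨x, hx⟩ := (Equiv.Perm.mem_cycleFactorsFinset_iff.1 hc).1.nonempty_support
      have hx' : x ∈ c'.support := by rw [← show c.support = c'.support from hcc]; exact hx
      rw [Equiv.Perm.cycle_is_cycleOf hx hc, ← Equiv.Perm.cycle_is_cycleOf hx' hc']
  have hs : g.support = h.support := by
    rw [(key g).1, (key h).1]; simp only [H]
  have hc : g.cycleFactorsFinset.card = h.cycleFactorsFinset.card := by
    rw [(key g).2, (key h).2, hs]; simp only [H]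
  rw [Equiv.Perm.sign_of_cycleType, Equiv.Perm.sign_of_cycleType, Equiv.Perm.sum_cycleType,
    Equiv.Perm.sum_cycleType, Equiv.Perm.cycleType_def, Equiv.Perm.cycleType_def,
    Multiset.card_map, Multiset.card_map, Finset.card_val, Finset.card_val, hs, hc]

/-- Every set partition is the orbit partition of some permutation. -/
theorem exists_perm_sameCycle_iff {n : ℕ} (κ : Setoid (Fin n)) :
    ∃ g : Equiv.Perm (Fin n), ∀ x y, g.SameCycle x y ↔ κ x y := by
  have hB : ∀ s : Finset (Fin n), ∃ f : Equiv.Perm (Fin n), f.IsCycleOn (s : Set (Fin n)) :=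
    fun s => (Finset.exists_cycleOn s).imp fun f hf => hf.1
  choose f hf using hB
  let B : Fin n → Finset (Fin n) := fun x => univ.filter (fun y => κ x y)
  have hBmem : ∀ x y, y ∈ B x ↔ κ x y := fun x y => by simp [B]
  have hBeq : ∀ x y, κ x y → B x = B y := by
    intro x y h
    ext z
    rw [hBmem, hBmem]
    exact ⟨fun hz => κ.trans (κ.symm h) hz, fun hz => κ.trans h hz⟩
  have hstep : ∀ x, κ x (f (B x) x) := by
    intro x
    rw [← hBmem]
    exact (hf (B x)).1.mapsTo ((hBmem x x).2 (κ.refl x))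
  have hinj : Function.Injective (fun x => f (B x) x) := by
    intro x y hxy
    have hxy' : f (B x) x = f (B y) y := hxy
    have h : κ x y := κ.trans (hstep x) (hxy' ▸ κ.symm (hstep y))
    rw [hBeq x y h] at hxy'
    exact (f (B y)).injective hxy'
  let g : Equiv.Perm (Fin n) :=
    Equiv.ofBijective _ (Finite.injective_iff_bijective.1 hinj)
  have hg : ∀ x, g x = f (B x) x := fun x => rfl
  have hpow : ∀ (k : ℕ) x, κ x ((g ^ k) x) ∧ (g ^ k) x = (f (B x) ^ k) x := by
    intro k
    induction k with
    | zero => intro x; exact ⟨κ.refl x, rfl⟩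
    | succ k ih =>
      intro x
      have h1 : (g ^ (k + 1)) x = g ((g ^ k) x) := by rw [pow_succ', Equiv.Perm.mul_apply]
      have h2 : (f (B x) ^ (k + 1)) x = f (B x) ((f (B x) ^ k) x) := by
        rw [pow_succ', Equiv.Perm.mul_apply]
      rw [h1, h2]
      refine ⟨κ.trans (ih x).1 (hstep _), ?_⟩
      rw [hg, ← hBeq _ _ (ih x).1, (ih x).2]
  refine ⟨g, fun x y => ⟨fun h => ?_, fun h => ?_⟩⟩
  · obtain ⟨k, -, rfl⟩ := h.exists_pow_eq'
    exact (hpow k x).1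
  · obtain ⟨k, -, hk⟩ := (hf (B x)).exists_pow_eq ((hBmem x x).2 (κ.refl x)) ((hBmem x y).2 h)
    exact ⟨k, by rw [zpow_natCast, (hpow k x).2, hk]⟩

/-- The sum of the signs of the permutations with orbit partition `κ`. -/
noncomputable def signSum {n : ℕ} (κ : Setoid (Fin n)) : ℚ :=
  ∑ g : Equiv.Perm (Fin n),
    if Equiv.Perm.SameCycle.setoid g = κ then ((Equiv.Perm.sign g : ℤ) : ℚ) else 0

theorem signSum_ne_zero {n : ℕ} (κ : Setoid (Fin n)) : signSum κ ≠ 0 := by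
  obtain ⟨g, hg⟩ := exists_perm_sameCycle_iff κ
  have hgκ : Equiv.Perm.SameCycle.setoid g = κ := Setoid.ext hg
  have : signSum κ = ∑ h ∈ univ.filter (fun h => Equiv.Perm.SameCycle.setoid h = κ),
      ((Equiv.Perm.sign g : ℤ) : ℚ) := by
    rw [signSum, Finset.sum_filter]
    refine Finset.sum_congr rfl fun h _ => ?_
    split_ifs with hh
    · rw [sign_eq_of_sameCycle_iff (g := h) (h := g)]
      intro x y
      rw [hg, ← hh]
      rfl
    · rfl
  rw [this, Finset.sum_const, nsmul_eq_mul]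
  refine mul_ne_zero ?_ ?_
  · rw [Nat.cast_ne_zero, Finset.card_ne_zero]
    exact ⟨g, by simp [hgκ]⟩
  · rw [Int.cast_ne_zero]
    exact Units.ne_zero _

theorem sameCycle_setoid_le_iff {n : ℕ} (g : Equiv.Perm (Fin n)) (ρ : Setoid (Fin n)) :
    Equiv.Perm.SameCycle.setoid g ≤ ρ ↔ ∀ x, ρ x (g x) := by
  constructor
  · intro h x
    exact h (show g.SameCycle x (g x) from
      Equiv.Perm.sameCycle_apply_right.2 (Equiv.Perm.SameCycle.refl _ _))
  · intro h x y hxy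
    obtain ⟨k, -, rfl⟩ := (show g.SameCycle x y from hxy).exists_pow_eq'
    clear hxy
    induction k with
    | zero => exact ρ.refl x
    | succ k ih =>
      rw [pow_succ', Equiv.Perm.mul_apply]
      exact ρ.trans ih (h _)

theorem rel_swap {n : ℕ} {ρ : Setoid (Fin n)} {x y : Fin n} (h : ρ x y) (z : Fin n) :
    ρ z (Equiv.swap x y z) := by
  by_cases hzx : z = x
  · subst hzx; rw [Equiv.swap_apply_left]; exact h
  · by_cases hzy : z = y
    · subst hzy; rw [Equiv.swap_apply_right]; exact ρ.symm h
    · rw [Equiv.swap_apply_of_ne_of_ne hzx hzy]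

theorem sum_signSum_le {n : ℕ} (ρ : Setoid (Fin n)) :
    ∑ κ : Setoid (Fin n), (if κ ≤ ρ then signSum κ else 0) = if ρ = ⊥ then 1 else 0 := by
  have h1 : ∑ κ : Setoid (Fin n), (if κ ≤ ρ then signSum κ else 0)
      = ∑ g : Equiv.Perm (Fin n),
          if ∀ x, ρ x (g x) then ((Equiv.Perm.sign g : ℤ) : ℚ) else 0 := by
    have : ∀ κ : Setoid (Fin n), (if κ ≤ ρ then signSum κ else 0) =
        ∑ g : Equiv.Perm (Fin n), if Equiv.Perm.SameCycle.setoid g = κ then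
          (if κ ≤ ρ then ((Equiv.Perm.sign g : ℤ) : ℚ) else 0) else 0 := by
      intro κ
      split_ifs with h
      · rfl
      · simp
    rw [Finset.sum_congr rfl fun κ _ => this κ, Finset.sum_comm]
    refine Finset.sum_congr rfl fun g _ => ?_
    rw [Finset.sum_ite_eq]
    simp only [mem_univ, if_true, sameCycle_setoid_le_iff]
  rw [h1]
  split_ifs with hρ
  · subst hρ
    rw [Finset.sum_eq_single 1]
    · simp
    · intro g _ hg
      rw [if_neg]
      intro h
      exact hg (Equiv.ext fun x => (h x).symm)
    · simp
  · obtain ⟨x, y, hxy, hne⟩ : ∃ x y, ρ x y ∧ x ≠ y := by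
      by_contra! hcon
      exact hρ (le_bot_iff.1 fun x y h => hcon x y h)
    refine self_eq_neg.1 ?_
    rw [← Finset.sum_neg_distrib]
    refine Fintype.sum_equiv (Equiv.mulRight (Equiv.swap x y)) _ _ fun g => ?_
    have hiff : (∀ z, ρ z (g z)) ↔ ∀ z, ρ z ((g * Equiv.swap x y) z) := by
      constructor
      · intro h z
        exact ρ.trans (rel_swap hxy z) (h _)
      · intro h z
        have := ρ.trans (rel_swap hxy z) (h (Equiv.swap x y z))
        simpa using this
    simp only [Equiv.coe_mulRight, ← hiff, Equiv.Perm.sign_mul, Equiv.Perm.sign_swap hne]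
    split_ifs <;> simp

end SignedOrbits

section Basis

/-- The vectors of coefficients of `e`-expansions are determined by their values. -/
theorem eq_zero_of_sum_inf_eq_bot {n : ℕ} (a : Setoid (Fin n) → ℚ)
    (h : ∀ ρ, ∑ τ : Setoid (Fin n), a τ * (if τ ⊓ ρ = ⊥ then 1 else 0) = 0) : a = 0 := by
  let A : Setoid (Fin n) → ℚ := fun κ => ∑ τ : Setoid (Fin n), if κ ≤ τ then a τ else 0
  have hA : ∀ ρ, ∑ κ : Setoid (Fin n), (if κ ≤ ρ then signSum κ * A κ else 0) = 0 := by
    intro ρ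
    refine Eq.trans ?_ (h ρ)
    simp only [← sum_signSum_le, A, Finset.mul_sum]
    have : ∀ κ : Setoid (Fin n),
        (if κ ≤ ρ then ∑ τ : Setoid (Fin n), signSum κ * (if κ ≤ τ then a τ else 0) else 0)
        = ∑ τ : Setoid (Fin n), a τ * (if κ ≤ τ ⊓ ρ then signSum κ else 0) := by
      intro κ
      by_cases hκ : κ ≤ ρ
      · simp [hκ, mul_comm]
      · simp [hκ]
    rw [Finset.sum_congr rfl fun κ _ => this κ, Finset.sum_comm]
  have hA0 : ∀ ρ, A ρ = 0 := by
    intro ρ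
    induction ρ using WellFoundedLT.induction with
    | ind ρ ih =>
      have := hA ρ
      rw [Finset.sum_eq_single ρ] at this
      · rw [if_pos le_rfl] at this
        exact (mul_eq_zero.1 this).resolve_left (signSum_ne_zero ρ)
      · intro κ _ hκ
        split_ifs with hle
        · rw [ih κ (lt_of_le_of_ne hle hκ), mul_zero]
        · rfl
      · simp
  funext ρ
  induction ρ using WellFoundedGT.induction with
  | ind ρ ih =>
    have := hA0 ρ
    simp only [A] at this
    rw [Finset.sum_eq_single ρ] at this
    · simpa using this
    · intro τ _ hτ
      split_ifs with hle
      · exact ih τ (lt_of_le_of_ne hle (Ne.symm hτ))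
      · rfl
    · simp

theorem eFun_apply {n : ℕ} (τ : Setoid (Fin n)) (w : Fin n → ℕ) :
    eFun τ w = if τ ⊓ Setoid.ker w = ⊥ then 1 else 0 := by
  have : (∀ i j, i ≠ j → τ i j → w i ≠ w j) ↔ τ ⊓ Setoid.ker w = ⊥ := by
    constructor
    · intro h
      refine le_bot_iff.1 fun i j hij => ?_
      by_contra hne
      exact h i j hne hij.1 hij.2
    · intro h i j hne hτ hw
      exact hne (h.le (show (τ ⊓ Setoid.ker w) i j from ⟨hτ, hw⟩))
  simp only [eFun, this]

theorem exists_ker_eq {n : ℕ} (ρ : Setoid (Fin n)) : ∃ w : Fin n → ℕ, Setoid.ker w = ρ := by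
  refine ⟨fun i => ((Quotient.mk ρ i).out : ℕ), Setoid.ext fun i j => ?_⟩
  change (((Quotient.mk ρ i).out : Fin n) : ℕ) = ((Quotient.mk ρ j).out : Fin n) ↔ _
  rw [Fin.val_inj]
  constructor
  · intro h
    exact ρ.trans (ρ.symm (Quotient.mk_out i)) (h ▸ Quotient.mk_out j)
  · intro h
    rw [Quotient.sound h]

theorem sum_smul_eFun_injective {n : ℕ} {a b : Setoid (Fin n) → ℚ}
    (h : ∑ τ : Setoid (Fin n), a τ • eFun τ = ∑ τ : Setoid (Fin n), b τ • eFun τ) : a = b := by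
  rw [← sub_eq_zero]
  refine eq_zero_of_sum_inf_eq_bot _ fun ρ => ?_
  obtain ⟨w, rfl⟩ := exists_ker_eq ρ
  have := congrFun h w
  simp only [Finset.sum_apply, Pi.smul_apply, smul_eq_mul, eFun_apply] at this
  simp only [Pi.sub_apply, sub_mul, Finset.sum_sub_distrib, this, sub_self]

/-- A noncommutative symmetric function, that is, one whose values only depend on
the kernel of the word, is a linear combination of elementary ones. -/
theorem exists_eq_sum_smul_eFun {n : ℕ} {F : NCF n}
    (hF : ∀ w w' : Fin n → ℕ, (∀ i j, w i = w j ↔ w' i = w' j) → F w = F w') :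
    ∃ a : Setoid (Fin n) → ℚ, F = ∑ τ : Setoid (Fin n), a τ • eFun τ := by
  let T : (Setoid (Fin n) → ℚ) →ₗ[ℚ] (Setoid (Fin n) → ℚ) :=
    Matrix.mulVecLin (Matrix.of fun ρ τ => if τ ⊓ ρ = ⊥ then 1 else 0)
  have hT : ∀ a ρ, T a ρ = ∑ τ : Setoid (Fin n), a τ * (if τ ⊓ ρ = ⊥ then 1 else 0) := by
    intro a ρ
    simp [T, Matrix.mulVec, dotProduct]
  have hinj : Function.Injective T := by
    rw [← LinearMap.ker_eq_bot, LinearMap.ker_eq_bot']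
    intro a ha
    refine eq_zero_of_sum_inf_eq_bot a fun ρ => ?_
    rw [← hT, ha, Pi.zero_apply]
  choose u hu using exists_ker_eq (n := n)
  obtain ⟨a, ha⟩ := LinearMap.injective_iff_surjective.1 hinj (fun ρ => F (u ρ))
  refine ⟨a, funext fun w => ?_⟩
  have := congrFun ha (Setoid.ker w)
  rw [hT] at this
  simp only [Finset.sum_apply, Pi.smul_apply, smul_eq_mul, eFun_apply, this]
  refine hF _ _ fun i j => ?_
  change Setoid.ker w i j ↔ Setoid.ker (u (Setoid.ker w)) i j
  rw [hu]

end Basis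

section Congruence

theorem blockCard_eq_of_rel {n : ℕ} {π : Setoid (Fin n)} {i j : Fin n} (h : π i j) :
    univ.filter (fun x => π i x) = univ.filter (fun x => π j x) := by
  ext x
  simp only [mem_filter, mem_univ, true_and]
  exact ⟨fun hx => π.trans (π.symm h) hx, fun hx => π.trans h hx⟩

theorem blockCard_pos {n : ℕ} (π : Setoid (Fin n)) (i : Fin n) : 0 < blockCard π i :=
  Finset.card_pos.2 ⟨i, by simp⟩

theorem count_sizes_mul {n : ℕ} (π : Setoid (Fin n)) (k : ℕ) :
    (sizes π).count k * k = (univ.filter (fun i => blockCard π i = k)).card := by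
  rw [sizes, Multiset.count_map,
    Finset.card_eq_sum_card_image (fun i => univ.filter (fun j => π i j))
      (univ.filter (fun i => blockCard π i = k))]
  have himg : (univ.filter (fun i => blockCard π i = k)).image
      (fun i => univ.filter (fun j => π i j))
      = (univ.image (fun i => univ.filter (fun j => π i j))).filter (fun B => k = B.card) := by
    ext B
    simp only [mem_image, mem_filter, mem_univ, true_and]
    constructor
    · rintro ⟨i, hi, rfl⟩
      exact ⟨⟨i, rfl⟩, hi.symm⟩
    · rintro ⟨⟨i, rfl⟩, hi⟩
      exact ⟨i, hi.symm, rfl⟩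
  rw [himg, Finset.sum_congr rfl (g := fun _ => k), Finset.sum_const, smul_eq_mul]
  · rfl
  · intro B hB
    simp only [mem_image, mem_filter, mem_univ, true_and] at hB
    obtain ⟨⟨i, rfl⟩, hi⟩ := hB
    rw [hi]
    congr 1
    ext x
    simp only [mem_filter, mem_univ, true_and]
    constructor
    · rintro ⟨-, hx⟩
      have : x ∈ univ.filter (fun j => π x j) := by simp
      rw [hx] at this
      simpa using this
    · intro hx
      have := blockCard_eq_of_rel hx
      exact ⟨by rw [blockCard, this], this.symm⟩

theorem sizes_eq_iff {m n : ℕ} (σ : Setoid (Fin m)) (τ : Setoid (Fin n)) :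
    sizes σ = sizes τ ↔ ∀ k, (univ.filter (fun i => blockCard σ i = k)).card
      = (univ.filter (fun i => blockCard τ i = k)).card := by
  constructor
  · intro h k
    rw [← count_sizes_mul, ← count_sizes_mul, h]
  · intro h
    ext k
    rcases Nat.eq_zero_or_pos k with rfl | hk
    · have h0 : ∀ {l : ℕ} (π : Setoid (Fin l)), (sizes π).count 0 = 0 := by
        intro l π
        rw [Multiset.count_eq_zero]
        intro hmem
        simp only [sizes, Multiset.mem_map, Finset.mem_val, mem_image, mem_univ,
          true_and] at hmem
        obtain ⟨_, ⟨i, rfl⟩, hi⟩ := hmem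
        exact (blockCard_pos π i).ne' hi
      rw [h0, h0]
    · have := h k
      rw [← count_sizes_mul, ← count_sizes_mul] at this
      exact Nat.eq_of_mul_eq_mul_right hk this

theorem cls_refl {n : ℕ} (i : Fin n) (σ : Setoid (Fin n)) : cls i σ σ := ⟨rfl, rfl⟩

theorem cls_symm {n : ℕ} {i : Fin n} {σ τ : Setoid (Fin n)} (h : cls i σ τ) : cls i τ σ :=
  ⟨h.1.symm, h.2.symm⟩

theorem cls_trans {n : ℕ} {i : Fin n} {σ τ ρ : Setoid (Fin n)} (h : cls i σ τ)
    (h' : cls i τ ρ) : cls i σ ρ :=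
  ⟨h.1.trans h'.1, h.2.trans h'.2⟩

theorem cls_congr_left {n : ℕ} {i : Fin n} {σ τ : Setoid (Fin n)} (h : cls i σ τ)
    (ρ : Setoid (Fin n)) : cls i σ ρ ↔ cls i τ ρ :=
  ⟨cls_trans (cls_symm h), cls_trans h⟩

/-- A family constant on the classes of `≡ᵢ` is summed through amalgamated coefficients. -/
theorem sum_smul_eq_zero_of_amalgamated {n : ℕ} {i : Fin n} {M : Type*} [AddCommGroup M]
    [Module ℚ M] (a : Setoid (Fin n) → ℚ) (G : Setoid (Fin n) → M)
    (hG : ∀ σ τ, cls i σ τ → G σ = G τ)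
    (ha : ∀ τ, ∑ σ : Setoid (Fin n), (if cls i σ τ then a σ else 0) = 0) :
    ∑ τ : Setoid (Fin n), a τ • G τ = 0 := by
  let N : Setoid (Fin n) → ℚ := fun τ => ∑ σ : Setoid (Fin n), if cls i τ σ then 1 else 0
  have hN0 : ∀ τ, N τ ≠ 0 := by
    intro τ
    simp only [N, Finset.sum_boole, Nat.cast_ne_zero, Finset.card_ne_zero]
    exact ⟨τ, by simp [cls_refl]⟩
  have hN : ∀ σ τ, cls i σ τ → N σ = N τ := by
    intro σ τ h
    simp only [N, cls_congr_left h]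
  have h1 : ∀ τ, a τ • G τ
      = ∑ ρ : Setoid (Fin n), (if cls i τ ρ then a τ else 0) • ((N ρ)⁻¹ • G ρ) := by
    intro τ
    have : ∀ ρ, (if cls i τ ρ then a τ else 0) • ((N ρ)⁻¹ • G ρ)
        = ((if cls i τ ρ then (1 : ℚ) else 0)) • (a τ • (N τ)⁻¹ • G τ) := by
      intro ρ
      split_ifs with h
      · rw [hG _ _ h, hN _ _ h, one_smul]
      · simp
    rw [Finset.sum_congr rfl fun ρ _ => this ρ, ← Finset.sum_smul]
    change a τ • G τ = N τ • (a τ • (N τ)⁻¹ • G τ)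
    rw [smul_comm (N τ), smul_smul (N τ), mul_inv_cancel₀ (hN0 τ), one_smul]
  rw [Finset.sum_congr rfl fun τ _ => h1 τ, Finset.sum_comm]
  refine Finset.sum_eq_zero fun ρ _ => ?_
  rw [← Finset.sum_smul, ha, zero_smul]

/-- The span of the differences of `≡ᵢ`-equivalent elementary functions. -/
def clsSpan {n : ℕ} (i : Fin n) : Submodule ℚ (NCF n) :=
  Submodule.span ℚ {F | ∃ σ τ, cls i σ τ ∧ F = eFun σ - eFun τ}

theorem sub_mem_clsSpan {n : ℕ} {i : Fin n} {σ τ : Setoid (Fin n)} (h : cls i σ τ) :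
    eFun σ - eFun τ ∈ clsSpan i :=
  Submodule.subset_span ⟨σ, τ, h, rfl⟩

theorem exists_amalgamated_of_mem_clsSpan {n : ℕ} {i : Fin n} {F : NCF n}
    (hF : F ∈ clsSpan i) :
    ∃ a : Setoid (Fin n) → ℚ, F = ∑ τ : Setoid (Fin n), a τ • eFun τ ∧
      ∀ τ, ∑ σ : Setoid (Fin n), (if cls i σ τ then a σ else 0) = 0 := by
  induction hF using Submodule.span_induction with
  | mem F hF =>
    obtain ⟨σ, τ, h, rfl⟩ := hF
    refine ⟨fun ρ => (if ρ = σ then 1 else 0) - (if ρ = τ then 1 else 0), ?_, fun ρ => ?_⟩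
    · simp [sub_smul, Finset.sum_sub_distrib]
    · have : ∀ κ : Setoid (Fin n), (if cls i κ ρ then
          ((if κ = σ then (1 : ℚ) else 0) - (if κ = τ then 1 else 0)) else 0)
          = (if κ = σ then (if cls i κ ρ then 1 else 0) else 0)
            - (if κ = τ then (if cls i κ ρ then 1 else 0) else 0) := by
        intro κ
        split_ifs <;> simp
      rw [Finset.sum_congr rfl fun κ _ => this κ, Finset.sum_sub_distrib]
      simp [cls_congr_left h]
  | zero => exact ⟨0, by simp, by simp⟩
  | add F G _ _ hF hG =>
    obtain ⟨a, rfl, ha⟩ := hF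
    obtain ⟨b, rfl, hb⟩ := hG
    refine ⟨a + b, by simp [add_smul, Finset.sum_add_distrib], fun τ => ?_⟩
    have : ∀ σ, (if cls i σ τ then (a + b) σ else 0)
        = (if cls i σ τ then a σ else 0) + (if cls i σ τ then b σ else 0) := by
      intro σ
      split_ifs <;> simp
    rw [Finset.sum_congr rfl fun σ _ => this σ, Finset.sum_add_distrib, ha, hb, add_zero]
  | smul r F _ hF =>
    obtain ⟨a, rfl, ha⟩ := hF
    refine ⟨r • a, by simp [Finset.smul_sum, smul_smul], fun τ => ?_⟩
    have : ∀ σ, (if cls i σ τ then (r • a) σ else 0) = r * (if cls i σ τ then a σ else 0) := by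
      intro σ
      split_ifs <;> simp
    rw [Finset.sum_congr rfl fun σ _ => this σ, ← Finset.mul_sum, ha, mul_zero]

theorem equivI_of_sub_mem_clsSpan {n : ℕ} {i : Fin n} {F G : NCF n} {b : Setoid (Fin n) → ℚ}
    (hG : G = ∑ τ : Setoid (Fin n), b τ • eFun τ) (h : F - G ∈ clsSpan i) :
    ∃ a : Setoid (Fin n) → ℚ, F = ∑ τ : Setoid (Fin n), a τ • eFun τ ∧
      ∀ τ, (∑ σ : Setoid (Fin n), if cls i σ τ then a σ else 0)
        = ∑ σ : Setoid (Fin n), if cls i σ τ then b σ else 0 := by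
  obtain ⟨c, hc, hc0⟩ := exists_amalgamated_of_mem_clsSpan h
  refine ⟨b + c, ?_, fun τ => ?_⟩
  · rw [← sub_add_cancel F G, hc, hG]
    simp [add_smul, Finset.sum_add_distrib, add_comm]
  · have : ∀ σ, (if cls i σ τ then (b + c) σ else 0)
        = (if cls i σ τ then b σ else 0) + (if cls i σ τ then c σ else 0) := by
      intro σ
      split_ifs <;> simp
    rw [Finset.sum_congr rfl fun σ _ => this σ, Finset.sum_add_distrib, hc0, add_zero]

theorem act_eFun {n : ℕ} (δ : Equiv.Perm (Fin n)) (τ : Setoid (Fin n)) :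
    act δ (eFun τ) = eFun (Setoid.comap δ.symm τ) := by
  funext w
  have : (∀ i j, i ≠ j → τ i j → (w ∘ δ) i ≠ (w ∘ δ) j) ↔
      ∀ i j, i ≠ j → (Setoid.comap δ.symm τ) i j → w i ≠ w j := by
    constructor
    · intro h i j hij hτ
      have := h (δ.symm i) (δ.symm j) (by simpa using hij) hτ
      simpa using this
    · intro h i j hij hτ
      refine h (δ i) (δ j) (by simpa using hij) ?_
      simpa [Setoid.comap_rel] using hτ
  simp only [act, eFun, this]

theorem blockCard_comap {n : ℕ} (δ : Equiv.Perm (Fin n)) (τ : Setoid (Fin n)) (i : Fin n) :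
    blockCard (Setoid.comap δ.symm τ) i = blockCard τ (δ.symm i) := by
  refine Finset.card_equiv δ.symm fun j => ?_
  simp [Setoid.comap_rel]

theorem cls_comap {n : ℕ} {i : Fin n} {δ : Equiv.Perm (Fin n)} (hδ : δ i = i)
    (τ : Setoid (Fin n)) : cls i (Setoid.comap δ.symm τ) τ := by
  refine ⟨(sizes_eq_iff _ _).2 fun k => Finset.card_equiv δ.symm fun j => ?_, ?_⟩
  · simp [blockCard_comap]
  · rw [blockCard_comap, δ.symm_apply_eq.2 hδ.symm]

/-- Permuting positions while fixing `i` preserves the congruence class modulo `i`. -/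
theorem act_sub_mem_clsSpan {n : ℕ} {i : Fin n} {δ : Equiv.Perm (Fin n)} (hδ : δ i = i)
    {F : NCF n}
    (hF : ∀ w w' : Fin n → ℕ, (∀ i j, w i = w j ↔ w' i = w' j) → F w = F w') :
    act δ F - F ∈ clsSpan i := by
  obtain ⟨a, rfl⟩ := exists_eq_sum_smul_eFun hF
  have : act δ (∑ τ : Setoid (Fin n), a τ • eFun τ) - ∑ τ : Setoid (Fin n), a τ • eFun τ
      = ∑ τ : Setoid (Fin n), a τ • (eFun (Setoid.comap δ.symm τ) - eFun τ) := by
    simp only [← act_eFun, smul_sub, Finset.sum_sub_distrib]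
    congr 1
    funext w
    simp [act, Finset.sum_apply]
  rw [this]
  exact Submodule.sum_mem _ fun τ _ =>
    Submodule.smul_mem _ _ (sub_mem_clsSpan (cls_comap hδ τ))

end Congruence

section Recursion

theorem addSingleton_castSucc {n : ℕ} (τ : Setoid (Fin (n + 1))) (i j : Fin (n + 1)) :
    addSingleton τ i.castSucc j.castSucc ↔ τ i j := by
  constructor
  · rintro (h | ⟨_, _, h⟩ | ⟨h1 | ⟨_, h1⟩, h2 | ⟨_, h2⟩⟩)
    · rw [Fin.castSucc_inj.1 h]
    · exact h
    · exact τ.trans h1.2 (τ.symm h2.2)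
    · exact h2.elim
    · exact h1.elim
    · exact h1.elim
  · exact fun h => Or.inr (Or.inl ⟨i.2, j.2, h⟩)

theorem addSingleton_last {n : ℕ} (τ : Setoid (Fin (n + 1))) (j : Fin (n + 1)) :
    ¬ addSingleton τ (Fin.last (n + 1)) j.castSucc := by
  rintro (h | ⟨h, _, _⟩ | ⟨⟨h, _⟩ | ⟨_, h⟩, _⟩)
  · exact (Fin.castSucc_lt_last j).ne' h
  · exact lt_irrefl _ h
  · exact lt_irrefl _ h
  · exact h

theorem addLast_castSucc {n : ℕ} (τ : Setoid (Fin (n + 1))) (i j : Fin (n + 1)) :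
    addLast τ i.castSucc j.castSucc ↔ τ i j := by
  constructor
  · rintro (h | ⟨_, _, h⟩ | ⟨h1 | ⟨h1, _⟩, h2 | ⟨h2, _⟩⟩)
    · rw [Fin.castSucc_inj.1 h]
    · exact h
    · exact τ.trans h1.2 (τ.symm h2.2)
    · exact absurd j.2 (not_lt.2 h2)
    · exact absurd i.2 (not_lt.2 h1)
    · exact absurd i.2 (not_lt.2 h1)
  · exact fun h => Or.inr (Or.inl ⟨i.2, j.2, h⟩)

theorem addLast_last {n : ℕ} (τ : Setoid (Fin (n + 1))) (j : Fin (n + 1)) :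
    addLast τ (Fin.last (n + 1)) j.castSucc ↔ τ j (Fin.last n) := by
  constructor
  · rintro (h | ⟨h, _, _⟩ | ⟨_, ⟨_, h⟩ | ⟨h, _⟩⟩)
    · exact absurd h (Fin.castSucc_lt_last j).ne'
    · exact absurd h (lt_irrefl _)
    · exact h
    · exact absurd j.2 (not_lt.2 h)
  · exact fun h => Or.inr (Or.inr ⟨Or.inr ⟨le_rfl, trivial⟩, Or.inl ⟨j.2, h⟩⟩)

theorem card_filter_univ_castSucc {n : ℕ} (p : Fin (n + 1) → Prop) [DecidablePred p] :
    (univ.filter p).card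
      = (univ.filter (fun i : Fin n => p i.castSucc)).card + if p (Fin.last n) then 1 else 0 := by
  simp only [Finset.card_filter, Fin.sum_univ_castSucc]

theorem blockCard_addSingleton_castSucc {n : ℕ} (τ : Setoid (Fin (n + 1))) (i : Fin (n + 1)) :
    blockCard (addSingleton τ) i.castSucc = blockCard τ i := by
  have : ¬ addSingleton τ i.castSucc (Fin.last (n + 1)) :=
    fun h => addSingleton_last τ i ((addSingleton τ).symm h)
  rw [blockCard, card_filter_univ_castSucc, if_neg this]
  simp only [addSingleton_castSucc, add_zero]
  rfl

theorem blockCard_addSingleton_last {n : ℕ} (τ : Setoid (Fin (n + 1))) :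
    blockCard (addSingleton τ) (Fin.last (n + 1)) = 1 := by
  rw [blockCard, card_filter_univ_castSucc, if_pos ((addSingleton τ).refl _)]
  simp [addSingleton_last]

theorem blockCard_addLast_castSucc {n : ℕ} (τ : Setoid (Fin (n + 1))) (i : Fin (n + 1)) :
    blockCard (addLast τ) i.castSucc
      = blockCard τ i + if τ i (Fin.last n) then 1 else 0 := by
  have : addLast τ i.castSucc (Fin.last (n + 1)) ↔ τ i (Fin.last n) := by
    rw [(addLast τ).comm', addLast_last]
  rw [blockCard, card_filter_univ_castSucc]
  simp only [addLast_castSucc, this]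
  rfl

theorem blockCard_addLast_last {n : ℕ} (τ : Setoid (Fin (n + 1))) :
    blockCard (addLast τ) (Fin.last (n + 1)) = blockCard τ (Fin.last n) + 1 := by
  rw [blockCard, card_filter_univ_castSucc, if_pos ((addLast τ).refl _)]
  simp only [addLast_last, blockCard, Setoid.comm' τ (x := Fin.last n)]

theorem cls_addSingleton {n : ℕ} {σ τ : Setoid (Fin (n + 1))} (h : cls (Fin.last n) σ τ) :
    cls (Fin.last (n + 1)) (addSingleton σ) (addSingleton τ) := by
  refine ⟨(sizes_eq_iff _ _).2 fun k => ?_, ?_⟩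
  · simp only [card_filter_univ_castSucc, blockCard_addSingleton_castSucc,
      blockCard_addSingleton_last, (sizes_eq_iff _ _).1 h.1 k]
  · rw [blockCard_addSingleton_last, blockCard_addSingleton_last]

theorem card_blockCard_addLast {n : ℕ} (τ : Setoid (Fin (n + 1))) (k : ℕ) :
    (univ.filter (fun i => blockCard (addLast τ) i = k)).card
        + (if blockCard τ (Fin.last n) = k then k else 0)
      = (univ.filter (fun i => blockCard τ i = k)).card
        + if blockCard τ (Fin.last n) + 1 = k then k else 0 := by
  set b := blockCard τ (Fin.last n) with hb
  have hblock : ∀ i, τ i (Fin.last n) → blockCard τ i = b := fun i hi => by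
    rw [hb, blockCard, blockCard, blockCard_eq_of_rel hi]
  have hcard : ∀ (p : Prop) [Decidable p],
      (∑ i, if τ i (Fin.last n) ∧ p then 1 else 0) = if p then b else 0 := by
    intro p _
    split_ifs with hp
    · simp only [hp, and_true, hb, blockCard, Finset.card_filter,
        Setoid.comm' τ (x := Fin.last n)]
    · simp [hp]
  have h1 : (univ.filter (fun i => blockCard τ i = k)).card
      = (univ.filter (fun i => ¬ τ i (Fin.last n) ∧ blockCard τ i = k)).card
        + if b = k then b else 0 := by
    rw [← hcard, Finset.card_filter, Finset.card_filter, ← Finset.sum_add_distrib]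
    refine Finset.sum_congr rfl fun i _ => ?_
    by_cases hi : τ i (Fin.last n)
    · simp [hi, hblock i hi]
    · simp [hi]
  have h2 : (univ.filter (fun i : Fin (n + 1) => blockCard (addLast τ) i.castSucc = k)).card
      = (univ.filter (fun i => ¬ τ i (Fin.last n) ∧ blockCard τ i = k)).card
        + if b + 1 = k then b else 0 := by
    rw [← hcard, Finset.card_filter, Finset.card_filter, ← Finset.sum_add_distrib]
    refine Finset.sum_congr rfl fun i _ => ?_
    rw [blockCard_addLast_castSucc]
    by_cases hi : τ i (Fin.last n)
    · simp [hi, hblock i hi]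
    · simp [hi]
  rw [card_filter_univ_castSucc, h1, h2, blockCard_addLast_last, ← hb]
  split_ifs <;> omega

theorem cls_addLast {n : ℕ} {σ τ : Setoid (Fin (n + 1))} (h : cls (Fin.last n) σ τ) :
    cls (Fin.last (n + 1)) (addLast σ) (addLast τ) := by
  refine ⟨(sizes_eq_iff _ _).2 fun k => ?_, ?_⟩
  · have h1 := card_blockCard_addLast σ k
    have h2 := card_blockCard_addLast τ k
    rw [h.2, (sizes_eq_iff _ _).1 h.1 k, ← h2] at h1
    exact Nat.add_right_cancel h1
  · rw [blockCard_addLast_last, blockCard_addLast_last, h.2]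

theorem eFun_addSingleton {n : ℕ} (τ : Setoid (Fin (n + 1))) (w : Fin (n + 2) → ℕ) :
    eFun (addSingleton τ) w = eFun τ (fun i => w i.castSucc) := by
  have : (∀ i j, i ≠ j → addSingleton τ i j → w i ≠ w j) ↔
      ∀ i j : Fin (n + 1), i ≠ j → τ i j → w i.castSucc ≠ w j.castSucc := by
    constructor
    · intro h i j hij hτ
      exact h _ _ (fun he => hij (Fin.castSucc_inj.1 he)) ((addSingleton_castSucc τ i j).2 hτ)
    · intro h i j
      induction i using Fin.lastCases with
      | last =>
        induction j using Fin.lastCases with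
        | last => exact fun hne => absurd rfl hne
        | cast j => exact fun _ hτ => absurd hτ (addSingleton_last τ j)
      | cast i =>
        induction j using Fin.lastCases with
        | last => exact fun _ hτ => absurd ((addSingleton τ).symm hτ) (addSingleton_last τ i)
        | cast j =>
          exact fun hne hτ => h i j (fun he => hne (he ▸ rfl)) ((addSingleton_castSucc τ i j).1 hτ)
  simp only [eFun, this]

theorem eFun_addLast {n : ℕ} (τ : Setoid (Fin (n + 1))) (w : Fin (n + 2) → ℕ) :
    eFun (addLast τ) w = if ∀ j : Fin (n + 1), τ j (Fin.last n) →
      w (Fin.last (n + 1)) ≠ w j.castSucc then eFun τ (fun i => w i.castSucc) else 0 := by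
  have : (∀ i j, i ≠ j → addLast τ i j → w i ≠ w j) ↔
      (∀ j : Fin (n + 1), τ j (Fin.last n) → w (Fin.last (n + 1)) ≠ w j.castSucc) ∧
      ∀ i j : Fin (n + 1), i ≠ j → τ i j → w i.castSucc ≠ w j.castSucc := by
    constructor
    · intro h
      refine ⟨fun j hj => h _ _ (Fin.castSucc_lt_last j).ne' ((addLast_last τ j).2 hj),
        fun i j hij hτ => ?_⟩
      exact h _ _ (fun he => hij (Fin.castSucc_inj.1 he)) ((addLast_castSucc τ i j).2 hτ)
    · rintro ⟨h, h'⟩ i j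
      induction i using Fin.lastCases with
      | last =>
        induction j using Fin.lastCases with
        | last => exact fun hne => absurd rfl hne
        | cast j => exact fun _ hτ => h j ((addLast_last τ j).1 hτ)
      | cast i =>
        induction j using Fin.lastCases with
        | last => exact fun _ hτ => (h i ((addLast_last τ i).1 ((addLast τ).symm hτ))).symm
        | cast j =>
          exact fun hne hτ => h' i j (fun he => hne (he ▸ rfl)) ((addLast_castSucc τ i j).1 hτ)
  simp only [eFun, this, ite_and]

/-- The difference counts the positions in the block of the last one whose letter is repeated. -/
theorem eFun_addSingleton_sub_eFun_addLast {n : ℕ} (τ : Setoid (Fin (n + 1)))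
    (w : Fin (n + 2) → ℕ) :
    eFun (addSingleton τ) w - eFun (addLast τ) w
      = ∑ j ∈ univ.filter (fun j => τ (Fin.last n) j),
          if w (Fin.last (n + 1)) = w j.castSucc then eFun τ (fun i => w i.castSucc) else 0 := by
  rw [eFun_addSingleton, eFun_addLast]
  split_ifs with h
  · rw [sub_self]
    refine (Finset.sum_eq_zero fun j hj => if_neg (h j ?_)).symm
    simpa using τ.symm (by simpa using hj)
  · push Not at h
    obtain ⟨j, hj, hw⟩ := h
    rw [sub_zero, Finset.sum_eq_single j]
    · rw [if_pos hw]
    · intro k hk hkj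
      split_ifs with hwk
      · rw [eFun, if_neg]
        intro hp
        exact hp k j hkj (τ.symm (τ.trans hj (by simpa using hk))) (hwk.symm.trans hw)
      · rfl
    · intro hj'
      exact absurd (τ.symm hj) (by simpa using hj')

theorem act_swap_eFun {n : ℕ} {τ : Setoid (Fin n)} {i j : Fin n} (h : τ i j) :
    act (Equiv.swap i j) (eFun τ) = eFun τ := by
  rw [act_eFun]
  congr 1
  ext x y
  rw [Setoid.comap_rel, Equiv.symm_swap]
  exact ⟨fun hxy => τ.trans (rel_swap h x) (τ.trans hxy (τ.symm (rel_swap h y))),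
    fun hxy => τ.trans (τ.symm (rel_swap h x)) (τ.trans hxy (rel_swap h y))⟩

theorem act_swap_up_eFun {n : ℕ} {τ : Setoid (Fin (n + 1))} {j : Fin (n + 1)}
    (h : τ (Fin.last n) j) (w : Fin (n + 2) → ℕ) :
    act (Equiv.swap (Fin.last n).castSucc j.castSucc) (up (eFun τ)) w
      = if w (Fin.last (n + 1)) = w j.castSucc then eFun τ (fun i => w i.castSucc) else 0 := by
  have h1 : Equiv.swap (Fin.last n).castSucc j.castSucc (Fin.last (n + 1)) = Fin.last (n + 1) :=
    Equiv.swap_apply_of_ne_of_ne (Fin.castSucc_lt_last _).ne' (Fin.castSucc_lt_last _).ne'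
  have h2 : Equiv.swap (Fin.last n).castSucc j.castSucc ⟨n, by omega⟩ = j.castSucc :=
    Equiv.swap_apply_left _ _
  have h3 : ∀ i : Fin (n + 1), Equiv.swap (Fin.last n).castSucc j.castSucc i.castSucc
      = (Equiv.swap (Fin.last n) j i).castSucc := fun i =>
    (Fin.castSucc_injective (n + 1)).swap_apply _ _ _
  have h4 := congrFun (act_swap_eFun h) (fun i => w i.castSucc)
  simp only [act, up, Function.comp_apply, h1, h2, h3] at h4 ⊢
  rw [← h4]
  rfl

theorem eFun_congr {n : ℕ} (τ : Setoid (Fin n)) {w w' : Fin n → ℕ}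
    (h : ∀ i j, w i = w j ↔ w' i = w' j) : eFun τ w = eFun τ w' := by
  simp only [eFun, ne_eq, h]

theorem up_eFun_congr {n : ℕ} (τ : Setoid (Fin (n + 1))) (w w' : Fin (n + 2) → ℕ)
    (h : ∀ i j, w i = w j ↔ w' i = w' j) : up (eFun τ) w = up (eFun τ) w' := by
  simp only [up, h, eFun_congr τ fun i j => h i.castSucc j.castSucc]

/-- The contribution of `e_τ` to the deletion-contraction recursion of paths. -/
noncomputable def pathStep {n : ℕ} (τ : Setoid (Fin (n + 1))) : NCF (n + 2) :=
  (1 - 1 / (blockCard τ (Fin.last n) : ℚ)) • eFun (addSingleton τ)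
    + (1 / (blockCard τ (Fin.last n) : ℚ)) • eFun (addLast τ)

theorem eFun_sub_up_sub_pathStep_mem {n : ℕ} (τ : Setoid (Fin (n + 1))) :
    eFun (addSingleton τ) - up (eFun τ) - pathStep τ ∈ clsSpan (Fin.last (n + 1)) := by
  have hb : (blockCard τ (Fin.last n) : ℚ) ≠ 0 :=
    Nat.cast_ne_zero.2 (blockCard_pos τ _).ne'
  have key : eFun (addSingleton τ) - eFun (addLast τ)
      - (blockCard τ (Fin.last n) : ℚ) • up (eFun τ) ∈ clsSpan (Fin.last (n + 1)) := by
    have : eFun (addSingleton τ) - eFun (addLast τ)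
        - (blockCard τ (Fin.last n) : ℚ) • up (eFun τ)
        = ∑ j ∈ univ.filter (fun j => τ (Fin.last n) j),
          (act (Equiv.swap (Fin.last n).castSucc j.castSucc) (up (eFun τ)) - up (eFun τ)) := by
      rw [Finset.sum_sub_distrib, Finset.sum_const, ← Nat.cast_smul_eq_nsmul ℚ]
      congr 1
      funext w
      rw [Pi.sub_apply, eFun_addSingleton_sub_eFun_addLast, Finset.sum_apply]
      exact Finset.sum_congr rfl fun j hj => (act_swap_up_eFun (by simpa using hj) w).symm
    rw [this]
    refine Submodule.sum_mem _ fun j _ => act_sub_mem_clsSpan ?_ (up_eFun_congr τ)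
    exact Equiv.swap_apply_of_ne_of_ne (Fin.castSucc_lt_last _).ne' (Fin.castSucc_lt_last _).ne'
  have : eFun (addSingleton τ) - up (eFun τ) - pathStep τ
      = (1 / (blockCard τ (Fin.last n) : ℚ)) • (eFun (addSingleton τ) - eFun (addLast τ)
        - (blockCard τ (Fin.last n) : ℚ) • up (eFun τ)) := by
    funext w
    simp only [pathStep, Pi.sub_apply, Pi.add_apply, Pi.smul_apply, smul_eq_mul]
    field_simp
    ring
  rw [this]
  exact Submodule.smul_mem _ _ key

theorem pathStep_sub_mem {n : ℕ} {σ τ : Setoid (Fin (n + 1))} (h : cls (Fin.last n) σ τ) :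
    pathStep σ - pathStep τ ∈ clsSpan (Fin.last (n + 1)) := by
  have : pathStep σ - pathStep τ
      = (1 - 1 / (blockCard τ (Fin.last n) : ℚ)) • (eFun (addSingleton σ) - eFun (addSingleton τ))
        + (1 / (blockCard τ (Fin.last n) : ℚ)) • (eFun (addLast σ) - eFun (addLast τ)) := by
    rw [pathStep, pathStep, h.2, smul_sub, smul_sub]
    abel
  rw [this]
  exact Submodule.add_mem _ (Submodule.smul_mem _ _ (sub_mem_clsSpan (cls_addSingleton h)))
    (Submodule.smul_mem _ _ (sub_mem_clsSpan (cls_addLast h)))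

theorem proper_pathEnds {n : ℕ} (w : Fin (n + 1) → ℕ) :
    Proper (pathEnds n) w ↔ ∀ e : Fin n, w e.castSucc ≠ w e.succ := by
  constructor
  · exact fun h e => h e _ _ rfl
  · intro h e i j hij
    rcases Sym2.eq_iff.1 hij with ⟨rfl, rfl⟩ | ⟨rfl, rfl⟩
    · exact h e
    · exact (h e).symm

/-- Deletion-contraction for the last edge of a path. -/
theorem Y_pathEnds_succ {n : ℕ} (w : Fin (n + 2) → ℕ) :
    Y (pathEnds (n + 1)) w
      = Y (pathEnds n) (fun i => w i.castSucc) - up (Y (pathEnds n)) w := by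
  have : Proper (pathEnds (n + 1)) w ↔
      w (Fin.last (n + 1)) ≠ w ⟨n, by omega⟩ ∧
        Proper (pathEnds n) (fun i => w i.castSucc) := by
    rw [proper_pathEnds, proper_pathEnds, Fin.forall_fin_succ', and_comm]
    exact and_congr_left' ne_comm
  simp only [Y, up, this]
  split_ifs <;> simp_all

/-- The recursion modulo the congruence, from any expansion of `Y_{P_n}`. -/
theorem Y_pathEnds_succ_sub_mem {n : ℕ} {a c : Setoid (Fin (n + 1)) → ℚ}
    (hY : Y (pathEnds n) = ∑ τ : Setoid (Fin (n + 1)), a τ • eFun τ)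
    (hac : ∀ τ, (∑ σ : Setoid (Fin (n + 1)), if cls (Fin.last n) σ τ then a σ else 0)
        = ∑ σ : Setoid (Fin (n + 1)), if cls (Fin.last n) σ τ then c σ else 0) :
    Y (pathEnds (n + 1)) - ∑ τ : Setoid (Fin (n + 1)), c τ • pathStep τ
      ∈ clsSpan (Fin.last (n + 1)) := by
  have h1 : Y (pathEnds (n + 1)) = ∑ τ : Setoid (Fin (n + 1)),
      a τ • (eFun (addSingleton τ) - up (eFun τ)) := by
    funext w
    rw [Y_pathEnds_succ, hY, Finset.sum_apply, Finset.sum_apply]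
    simp only [up, Finset.sum_apply, Pi.smul_apply, Pi.sub_apply, eFun_addSingleton, smul_sub,
      Finset.sum_sub_distrib]
    split_ifs <;> simp
  have h2 : ∑ τ : Setoid (Fin (n + 1)),
      (a τ - c τ) • (clsSpan (Fin.last (n + 1))).mkQ (pathStep τ) = 0 := by
    refine sum_smul_eq_zero_of_amalgamated (i := Fin.last n) _ _ (fun σ τ h => ?_) fun τ => ?_
    · exact (Submodule.Quotient.eq _).2 (pathStep_sub_mem h)
    · refine Eq.trans ?_ (sub_eq_zero.2 (hac τ))
      rw [← Finset.sum_sub_distrib]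
      refine Finset.sum_congr rfl fun σ _ => ?_
      by_cases hσ : cls (Fin.last n) σ τ <;> simp only [hσ, if_true, if_false, sub_zero]
  have h3 : Y (pathEnds (n + 1)) - ∑ τ : Setoid (Fin (n + 1)), c τ • pathStep τ
      = ∑ τ : Setoid (Fin (n + 1)), a τ • (eFun (addSingleton τ) - up (eFun τ) - pathStep τ)
        + ∑ τ : Setoid (Fin (n + 1)), (a τ - c τ) • pathStep τ := by
    rw [h1, ← Finset.sum_sub_distrib, ← Finset.sum_add_distrib]
    refine Finset.sum_congr rfl fun τ _ => ?_
    module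
  rw [h3]
  refine Submodule.add_mem _ (Submodule.sum_mem _ fun τ _ =>
    Submodule.smul_mem _ _ (eFun_sub_up_sub_pathStep_mem τ)) ?_
  rw [← Submodule.ker_mkQ (clsSpan (Fin.last (n + 1))), LinearMap.mem_ker, map_sum]
  simpa only [map_smul] using h2

theorem sum_smul_pathStep {n : ℕ} (c : Setoid (Fin (n + 1)) → ℚ) :
    ∑ τ : Setoid (Fin (n + 1)), c τ • pathStep τ
      = ∑ ρ : Setoid (Fin (n + 2)), (∑ τ : Setoid (Fin (n + 1)),
          ((if addSingleton τ = ρ then c τ * (1 - 1 / (blockCard τ (Fin.last n) : ℚ)) else 0)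
            + if addLast τ = ρ then c τ / (blockCard τ (Fin.last n) : ℚ) else 0)) • eFun ρ := by
  simp only [Finset.sum_smul, add_smul, ite_smul, zero_smul]
  rw [Finset.sum_comm]
  refine Finset.sum_congr rfl fun τ _ => ?_
  rw [Finset.sum_add_distrib, Finset.sum_ite_eq, Finset.sum_ite_eq, if_pos (mem_univ _),
    if_pos (mem_univ _), pathStep, smul_add, smul_smul, smul_smul, mul_one_div]

theorem exists_nonneg_Y_pathEnds (n : ℕ) :
    ∃ a c : Setoid (Fin (n + 1)) → ℚ,
      Y (pathEnds n) = ∑ τ : Setoid (Fin (n + 1)), a τ • eFun τ ∧ (∀ τ, 0 ≤ c τ) ∧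
      ∀ τ, (∑ σ : Setoid (Fin (n + 1)), if cls (Fin.last n) σ τ then a σ else 0)
        = ∑ σ : Setoid (Fin (n + 1)), if cls (Fin.last n) σ τ then c σ else 0 := by
  induction n with
  | zero =>
    refine ⟨fun τ => if τ = ⊥ then 1 else 0, fun τ => if τ = ⊥ then 1 else 0, ?_,
      fun τ => by dsimp only; split_ifs <;> simp, fun _ => rfl⟩
    simp only [ite_smul, one_smul, zero_smul, Finset.sum_ite_eq', mem_univ, if_true]
    funext w
    rw [eFun_apply, bot_inf_eq, if_pos rfl, Y, if_pos]
    exact fun e => e.elim0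
  | succ n ih =>
    obtain ⟨a, c, hY, hc, hac⟩ := ih
    obtain ⟨a', hY', ha'⟩ := equivI_of_sub_mem_clsSpan (sum_smul_pathStep c)
      (Y_pathEnds_succ_sub_mem hY hac)
    refine ⟨a', _, hY', fun ρ => Finset.sum_nonneg fun τ _ => ?_, ha'⟩
    have hb : (1 : ℚ) ≤ blockCard τ (Fin.last n) := by
      exact_mod_cast blockCard_pos τ (Fin.last n)
    have h1 : 0 ≤ 1 - 1 / (blockCard τ (Fin.last n) : ℚ) := by
      rw [sub_nonneg, div_le_one (by linarith)]
      exact hb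
    have h2 := hc τ
    refine add_nonneg ?_ ?_ <;> split_ifs <;> positivity

end Recursion

/-- Paths are `(e)`-positive, and the amalgamated coefficients satisfy the
deletion-contraction recursion from `P_{d}` to `P_{d+1}`. -/
theorem path_ePositive :
    (∀ d : ℕ, EPos (Fin.last d) (Y (pathEnds d))) ∧
    (∀ (d : ℕ) (c : Setoid (Fin (d + 1)) → ℚ),
      EquivI (Fin.last d) (Y (pathEnds d)) (∑ τ : Setoid (Fin (d + 1)), c τ • eFun τ) →
      EquivI (Fin.last (d + 1)) (Y (pathEnds (d + 1)))
        (∑ τ : Setoid (Fin (d + 1)),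
          ((c τ * (1 - 1 / (blockCard τ (Fin.last d) : ℚ))) • eFun (addSingleton τ)
            + (c τ / (blockCard τ (Fin.last d) : ℚ)) • eFun (addLast τ)))) := by
  refine ⟨fun d => ?_, fun d c h => ?_⟩
  · obtain ⟨a, c, hY, hc, hac⟩ := exists_nonneg_Y_pathEnds d
    refine ⟨a, hY, fun τ => ?_⟩
    rw [hac]
    refine Finset.sum_nonneg fun σ _ => ?_
    split_ifs
    · exact hc σ
    · exact le_rfl
  · obtain ⟨a, b, hY, hcb, hab⟩ := h
    obtain rfl := sum_smul_eFun_injective hcb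
    have hsum : ∑ τ : Setoid (Fin (d + 1)),
        ((c τ * (1 - 1 / (blockCard τ (Fin.last d) : ℚ))) • eFun (addSingleton τ)
          + (c τ / (blockCard τ (Fin.last d) : ℚ)) • eFun (addLast τ))
        = ∑ τ : Setoid (Fin (d + 1)), c τ • pathStep τ := by
      refine Finset.sum_congr rfl fun τ _ => ?_
      rw [pathStep, smul_add, smul_smul, smul_smul, mul_one_div]
    rw [hsum]
    obtain ⟨a', hY', ha'⟩ := equivI_of_sub_mem_clsSpan (sum_smul_pathStep c)
      (Y_pathEnds_succ_sub_mem hY hab)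
    exact ⟨a', _, hY', sum_smul_pathStep c, ha'⟩
end
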